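/- arXiv:math/0607345 — 5 statements merged into one kernel-verified Lean document; each statement's English description precedes it below -/
import Mathlib

section
/- For every α ∈ (0,2], c > 0, a > 0, t > 0 and L > 0, the averaged number variance of the infinite system of independent symmetric α-stable processes started from the equispaced configuration u_j = a(j−ε) satisfies the identity ∑_{j∈ℤ} ∫₀¹ q_j(ε)(1 − q_j(ε)) dε = L/a + (2/π) ∫₀^∞ θ^{-2} e^{-2ct(θ/a)^α} (cos(Lθ/a) − 1) dθ. -/
open MeasureTheory Filter Set

/-- Symmetric `α`-stable transition density at time `t`, defined by Fourier inversion. -/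
noncomputable def stablePDF (α c t z : ℝ) : ℝ :=
  (1 / Real.pi) * ∫ θ in Set.Ioi (0:ℝ), Real.cos (z * θ) * Real.exp (-(c * t * θ ^ α))

/-- Probability that the `j`-th particle, started from `a (j - ε)` and moved for time `t`
by a symmetric `α`-stable process, lies in `[0, L]`. -/
noncomputable def hitProb (α c t a L : ℝ) (j : ℤ) (ε : ℝ) : ℝ :=
  ∫ y in (0:ℝ)..L, stablePDF α c t (y - a * ((j : ℝ) - ε))

/-- The symmetric stable density with characteristic function `exp (-κ |θ| ^ α)`. -/
noncomputable def symStable (α κ z : ℝ) : ℝ :=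
  (1 / Real.pi) * ∫ θ in Ioi (0:ℝ), Real.cos (z * θ) * Real.exp (-(κ * θ ^ α))

lemma symStable_neg (α κ z : ℝ) : symStable α κ (-z) = symStable α κ z := by
  simp [symStable]

lemma integrableOn_rpow_mul_exp_neg {α κ s : ℝ} (hα : 0 < α) (hκ : 0 < κ) (hs : -1 < s) :
    IntegrableOn (fun θ : ℝ => θ ^ s * Real.exp (-(κ * θ ^ α))) (Ioi 0) := by
  simpa [neg_mul] using integrableOn_rpow_mul_exp_neg_mul_rpow hs hα hκ

lemma integrableOn_exp_neg_rpow {α κ : ℝ} (hα : 0 < α) (hκ : 0 < κ) :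
    IntegrableOn (fun θ : ℝ => Real.exp (-(κ * θ ^ α))) (Ioi 0) := by
  simpa using integrableOn_rpow_mul_exp_neg (s := 0) hα hκ (by norm_num)

lemma continuous_symStable {α κ : ℝ} (hα : 0 < α) (hκ : 0 < κ) :
    Continuous (symStable α κ) := by
  unfold symStable
  refine continuous_const.mul (continuous_of_dominated (fun z => ?_) (fun z => ?_)
    (integrableOn_exp_neg_rpow hα hκ) ?_)
  · exact (by fun_prop : Measurable fun θ : ℝ =>
      Real.cos (z * θ) * Real.exp (-(κ * θ ^ α))).aestronglyMeasurable
  · refine Eventually.of_forall fun θ => ?_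
    rw [norm_mul, Real.norm_eq_abs, Real.norm_eq_abs, Real.abs_exp]
    exact mul_le_of_le_one_left (Real.exp_pos _).le (Real.abs_cos_le_one _)
  · exact Eventually.of_forall fun θ => by fun_prop

lemma tendsto_rpow_mul_exp_neg_atTop {α κ : ℝ} (s : ℝ) (hα : 0 < α) (hκ : 0 < κ) :
    Tendsto (fun θ : ℝ => θ ^ s * Real.exp (-(κ * θ ^ α))) atTop (nhds 0) := by
  refine ((tendsto_rpow_mul_exp_neg_mul_atTop_nhds_zero (s / α) κ hκ).comp
    (tendsto_rpow_atTop hα)).congr' ?_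
  filter_upwards [eventually_gt_atTop 0] with θ hθ
  simp only [Function.comp_apply]
  rw [← Real.rpow_mul hθ.le, mul_div_cancel₀ _ hα.ne', neg_mul]

lemma hasDerivAt_exp_neg_rpow (α κ : ℝ) {θ : ℝ} (hθ : 0 < θ) :
    HasDerivAt (fun x : ℝ => Real.exp (-(κ * x ^ α)))
      (-(κ * α * θ ^ (α - 1) * Real.exp (-(κ * θ ^ α)))) θ := by
  refine (((Real.hasDerivAt_rpow_const (p := α)
    (Or.inl hθ.ne')).const_mul κ).fun_neg).exp.congr_deriv ?_
  ring

lemma hasDerivAt_rpow_mul_exp_neg_rpow (α κ : ℝ) {θ : ℝ} (hθ : 0 < θ) :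
    HasDerivAt (fun x : ℝ => κ * α * x ^ (α - 1) * Real.exp (-(κ * x ^ α)))
      (κ * α * ((α - 1) * θ ^ (α - 2) - κ * α * θ ^ (2 * α - 2)) *
        Real.exp (-(κ * θ ^ α))) θ := by
  refine (((Real.hasDerivAt_rpow_const (p := α - 1) (Or.inl hθ.ne')).const_mul (κ * α)).mul
    (hasDerivAt_exp_neg_rpow α κ hθ)).congr_deriv ?_
  have h : θ ^ (2 * α - 2) = θ ^ (α - 1) * θ ^ (α - 1) := by
    rw [← Real.rpow_add hθ]; ring_nf
  rw [h, show α - 1 - 1 = α - 2 by ring]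
  ring

/-- Interpolation between `1 - cos u ≤ 2` and `1 - cos u ≤ u ^ 2 / 2`. -/
lemma one_sub_cos_le_two_mul_rpow {u r : ℝ} (hu : 0 < u) (hr0 : 0 ≤ r) (hr2 : r ≤ 2) :
    1 - Real.cos u ≤ 2 * u ^ r := by
  rcases le_total 1 u with h | h
  · have := Real.one_le_rpow h hr0
    linarith [Real.neg_one_le_cos u]
  · have h2 : u ^ (2:ℝ) ≤ u ^ r := Real.rpow_le_rpow_of_exponent_ge hu h hr2
    rw [Real.rpow_two] at h2
    have := Real.one_sub_sq_div_two_le_cos (x := u)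
    nlinarith [sq_nonneg u]

lemma integrableOn_stableMajorant {α κ : ℝ} (hα : 0 < α) (hκ : 0 < κ) :
    IntegrableOn (fun θ : ℝ => κ * α * (|α - 1| * θ ^ (α / 2 - 1) +
      κ * α * θ ^ (3 * α / 2 - 1)) * Real.exp (-(κ * θ ^ α))) (Ioi 0) := by
  have h1 := ((integrableOn_rpow_mul_exp_neg (s := α / 2 - 1) hα hκ (by linarith)).const_mul
    (κ * α * |α - 1|))
  have h2 := ((integrableOn_rpow_mul_exp_neg (s := 3 * α / 2 - 1) hα hκ (by linarith)).const_mul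
    (κ * α * (κ * α)))
  refine (h1.add h2).congr (Eventually.of_forall fun θ => ?_)
  simp only [Pi.add_apply]
  ring

lemma abs_stableSecondDeriv_mul_one_sub_cos_le {α κ z θ : ℝ} (hα : α ∈ Ioc (0:ℝ) 2)
    (hκ : 0 < κ) (hz : 0 < z) (hθ : 0 < θ) :
    |(κ * α * ((α - 1) * θ ^ (α - 2) - κ * α * θ ^ (2 * α - 2)) *
        Real.exp (-(κ * θ ^ α))) * (1 - Real.cos (z * θ))| ≤
      2 * z ^ (1 - α / 2) * (κ * α * (|α - 1| * θ ^ (α / 2 - 1) +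
        κ * α * θ ^ (3 * α / 2 - 1)) * Real.exp (-(κ * θ ^ α))) := by
  have hα0 := hα.1
  have hc := one_sub_cos_le_two_mul_rpow (r := 1 - α / 2) (mul_pos hz hθ)
    (by linarith [hα.2]) (by linarith)
  have hc0 : 0 ≤ 1 - Real.cos (z * θ) := by linarith [Real.cos_le_one (z * θ)]
  have h1 : θ ^ (α / 2 - 1) = θ ^ (α - 2) * θ ^ (1 - α / 2) := by
    rw [← Real.rpow_add hθ]; ring_nf
  have h2 : θ ^ (3 * α / 2 - 1) = θ ^ (2 * α - 2) * θ ^ (1 - α / 2) := by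
    rw [← Real.rpow_add hθ]; ring_nf
  rw [abs_mul, abs_mul, abs_mul, Real.abs_exp, abs_of_pos (mul_pos hκ hα0), abs_of_nonneg hc0]
  calc _ ≤ κ * α * (|α - 1| * θ ^ (α - 2) + κ * α * θ ^ (2 * α - 2)) *
        Real.exp (-(κ * θ ^ α)) * (2 * (z * θ) ^ (1 - α / 2)) := by
        gcongr
        refine (abs_sub _ _).trans (le_of_eq ?_)
        rw [abs_mul, abs_of_pos (Real.rpow_pos_of_pos hθ _),
          abs_of_pos (mul_pos (mul_pos hκ hα0) (Real.rpow_pos_of_pos hθ _))]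
    _ = _ := by
        rw [Real.mul_rpow hz.le hθ.le, h1, h2]
        ring

/-- Integrating by parts twice in the inversion formula. -/
lemma symStable_eq_integral_one_sub_cos {α κ z : ℝ} (hα : α ∈ Ioc (0:ℝ) 2) (hκ : 0 < κ)
    (hz : 0 < z) :
    symStable α κ z = -(1 / Real.pi) * (1 / z ^ 2) *
      ∫ θ in Ioi (0:ℝ), (κ * α * ((α - 1) * θ ^ (α - 2) - κ * α * θ ^ (2 * α - 2)) *
        Real.exp (-(κ * θ ^ α))) * (1 - Real.cos (z * θ)) := by
  have hα0 := hα.1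
  have hφ := integrableOn_exp_neg_rpow hα0 hκ
  have hK := integrableOn_stableMajorant hα0 hκ
  have hg : IntegrableOn (fun θ : ℝ => κ * α * θ ^ (α - 1) * Real.exp (-(κ * θ ^ α)))
      (Ioi 0) := by
    simp only [mul_assoc]
    exact ((integrableOn_rpow_mul_exp_neg (s := α - 1) hα0 hκ (by linarith)).const_mul
      α).const_mul κ
  have hsin : ∀ θ : ℝ, HasDerivAt (fun x => Real.sin (z * x) / z) (Real.cos (z * θ)) θ := by
    intro θ
    refine (((hasDerivAt_id θ).const_mul z).sin.div_const z).congr_deriv ?_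
    simp [hz.ne']
  have hcos : ∀ θ : ℝ, HasDerivAt (fun x => (1 - Real.cos (z * x)) / z) (Real.sin (z * θ)) θ := by
    intro θ
    refine ((((hasDerivAt_id θ).const_mul z).cos.const_sub 1).div_const z).congr_deriv ?_
    simp [hz.ne']
  have hsin_le : ∀ θ : ℝ, ‖Real.sin (z * θ) / z‖ ≤ 1 / z := by
    intro θ
    rw [norm_div, Real.norm_eq_abs, Real.norm_eq_abs, abs_of_pos hz]
    gcongr
    exact Real.abs_sin_le_one _
  have h1 := integral_Ioi_mul_deriv_eq_deriv_mul (a := 0) (a' := 0) (b' := 0)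
    (u := fun θ : ℝ => Real.exp (-(κ * θ ^ α)))
    (fun θ hθ => hasDerivAt_exp_neg_rpow α κ hθ) (fun θ _ => hsin θ)
    (hφ.mul_bdd (c := 1) (by fun_prop) (Eventually.of_forall fun θ => Real.abs_cos_le_one _))
    (hg.neg.mul_bdd (c := 1 / z) (by fun_prop) (Eventually.of_forall hsin_le))
    (by
      have : Continuous fun θ : ℝ => Real.sin (z * θ) / z := by fun_prop
      have h := (this.norm.tendsto 0).mono_left (nhdsWithin_le_nhds (s := Ioi 0))
      simp only [mul_zero, Real.sin_zero, zero_div, norm_zero] at h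
      refine squeeze_zero_norm' ?_ h
      filter_upwards [self_mem_nhdsWithin] with θ hθ
      rw [Pi.mul_apply, norm_mul, Real.norm_of_nonneg (Real.exp_pos _).le]
      refine mul_le_of_le_one_left (norm_nonneg _) (Real.exp_le_one_iff.2 ?_)
      have := Real.rpow_nonneg (le_of_lt hθ) α
      nlinarith)
    (by
      have h := tendsto_rpow_mul_exp_neg_atTop 0 hα0 hκ
      simp only [Real.rpow_zero, one_mul] at h
      exact h.zero_mul_isBoundedUnder_le (isBoundedUnder_of ⟨1 / z, hsin_le⟩))
  have h2 := integral_Ioi_mul_deriv_eq_deriv_mul (a := 0) (a' := 0) (b' := 0)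
    (u := fun θ : ℝ => κ * α * θ ^ (α - 1) * Real.exp (-(κ * θ ^ α)))
    (fun θ hθ => hasDerivAt_rpow_mul_exp_neg_rpow α κ hθ) (fun θ _ => hcos θ)
    (hg.mul_bdd (c := 1) (by fun_prop) (Eventually.of_forall fun θ => Real.abs_sin_le_one _))
    (by
      refine ((hK.const_mul (2 * z ^ (1 - α / 2) / z)).mono' (by fun_prop) ?_)
      filter_upwards [ae_restrict_mem measurableSet_Ioi] with θ hθ
      have := abs_stableSecondDeriv_mul_one_sub_cos_le hα hκ hz hθ
      rw [Pi.mul_apply, ← mul_div_assoc, norm_div, Real.norm_eq_abs, Real.norm_of_nonneg hz.le,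
        div_mul_eq_mul_div]
      gcongr)
    (by
      have h : Tendsto (fun θ : ℝ => κ * α * (2 * z ^ (1 - α / 2) / z) * θ ^ (α / 2))
          (nhdsWithin 0 (Ioi 0)) (nhds 0) := by
        have : Continuous fun θ : ℝ => κ * α * (2 * z ^ (1 - α / 2) / z) * θ ^ (α / 2) :=
          continuous_const.mul (continuous_id.rpow_const fun _ => Or.inr (by linarith))
        have h := this.tendsto 0
        rw [Real.zero_rpow (by linarith), mul_zero] at h
        exact h.mono_left nhdsWithin_le_nhds
      refine squeeze_zero_norm' ?_ h
      filter_upwards [self_mem_nhdsWithin] with θ (hθ : 0 < θ)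
      have hc := one_sub_cos_le_two_mul_rpow (r := 1 - α / 2) (mul_pos hz hθ)
        (by linarith [hα.2]) (by linarith)
      have hc0 : 0 ≤ 1 - Real.cos (z * θ) := by linarith [Real.cos_le_one (z * θ)]
      have he : Real.exp (-(κ * θ ^ α)) ≤ 1 := by
        refine Real.exp_le_one_iff.2 ?_
        have := Real.rpow_nonneg hθ.le α
        nlinarith
      rw [Pi.mul_apply, Real.norm_of_nonneg (by positivity)]
      calc κ * α * θ ^ (α - 1) * Real.exp (-(κ * θ ^ α)) * ((1 - Real.cos (z * θ)) / z)
          ≤ κ * α * θ ^ (α - 1) * 1 * (2 * (z * θ) ^ (1 - α / 2) / z) := by gcongr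
        _ = κ * α * (2 * z ^ (1 - α / 2) / z) * (θ ^ (α - 1) * θ ^ (1 - α / 2)) := by
          rw [Real.mul_rpow hz.le hθ.le]; ring
        _ = _ := by rw [← Real.rpow_add hθ]; ring_nf)
    (by
      have h := (tendsto_rpow_mul_exp_neg_atTop (α - 1) hα0 hκ).const_mul (κ * α)
      simp only [← mul_assoc, mul_zero] at h
      refine h.zero_mul_isBoundedUnder_le (isBoundedUnder_of ⟨2 / z, fun θ => ?_⟩)
      have hc0 : 0 ≤ 1 - Real.cos (z * θ) := by linarith [Real.cos_le_one (z * θ)]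
      simp only [Function.comp_apply]
      rw [Real.norm_of_nonneg (by positivity)]
      gcongr
      linarith [Real.neg_one_le_cos (z * θ)])
  have e1 : ∫ θ in Ioi (0:ℝ), Real.cos (z * θ) * Real.exp (-(κ * θ ^ α)) =
      z⁻¹ * ∫ θ in Ioi (0:ℝ), κ * α * θ ^ (α - 1) * Real.exp (-(κ * θ ^ α)) *
        Real.sin (z * θ) := by
    rw [← integral_const_mul]
    simp only [mul_comm (Real.cos _)]
    rw [h1, sub_zero, zero_sub, ← integral_neg]
    congr with θ
    field_simp
  have e2 : ∫ θ in Ioi (0:ℝ), κ * α * θ ^ (α - 1) * Real.exp (-(κ * θ ^ α)) *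
        Real.sin (z * θ) = -(z⁻¹ * ∫ θ in Ioi (0:ℝ),
      (κ * α * ((α - 1) * θ ^ (α - 2) - κ * α * θ ^ (2 * α - 2)) *
        Real.exp (-(κ * θ ^ α))) * (1 - Real.cos (z * θ))) := by
    rw [← integral_const_mul, h2, sub_zero, zero_sub]
    congr with θ
    field_simp
  rw [symStable, e1, e2]
  field_simp

lemma symStable_isBigO {α κ : ℝ} (hα : α ∈ Ioc (0:ℝ) 2) (hκ : 0 < κ) :
    symStable α κ =O[atTop] fun z : ℝ => z ^ (-1 - α / 2) := by
  have hK := integrableOn_stableMajorant hα.1 hκ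
  set K := ∫ θ in Ioi (0:ℝ), κ * α * (|α - 1| * θ ^ (α / 2 - 1) +
      κ * α * θ ^ (3 * α / 2 - 1)) * Real.exp (-(κ * θ ^ α)) with hKdef
  refine Asymptotics.IsBigO.of_bound (1 / Real.pi * 2 * K) ?_
  filter_upwards [eventually_gt_atTop 0] with z hz
  have hle := norm_integral_le_of_norm_le
    (f := fun θ : ℝ => (κ * α * ((α - 1) * θ ^ (α - 2) - κ * α * θ ^ (2 * α - 2)) *
        Real.exp (-(κ * θ ^ α))) * (1 - Real.cos (z * θ))) (hK.const_mul (2 * z ^ (1 - α / 2)))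
    ((ae_restrict_mem measurableSet_Ioi).mono fun θ hθ =>
      abs_stableSecondDeriv_mul_one_sub_cos_le hα hκ hz hθ)
  rw [integral_const_mul, ← hKdef] at hle
  rw [symStable_eq_integral_one_sub_cos hα hκ hz, norm_mul,
    Real.norm_of_nonneg (Real.rpow_nonneg hz.le _)]
  have hn : ‖-(1 / Real.pi) * (1 / z ^ 2)‖ = 1 / Real.pi * (1 / z ^ 2) := by
    rw [neg_mul, norm_neg, Real.norm_of_nonneg (by positivity)]
  have hz' : z ^ (-1 - α / 2) = z ^ (1 - α / 2) * (1 / z ^ 2) := by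
    rw [show -1 - α / 2 = 1 - α / 2 - (2:ℕ) by push_cast; ring, Real.rpow_sub_natCast hz.ne']
    ring
  rw [hn, hz']
  calc _ ≤ 1 / Real.pi * (1 / z ^ 2) * (2 * z ^ (1 - α / 2) * K) := by gcongr
    _ = _ := by ring

lemma integrable_symStable {α κ : ℝ} (hα : α ∈ Ioc (0:ℝ) 2) (hκ : 0 < κ) :
    Integrable (symStable α κ) := by
  refine LocallyIntegrable.integrable_of_isBigO_atTop_of_norm_isNegInvariant
    (continuous_symStable hα.1 hκ).locallyIntegrable
    (Eventually.of_forall fun z => by simp [symStable_neg]) (symStable_isBigO hα hκ)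
    (integrableAtFilter_rpow_atTop_iff.2 (by linarith [hα.1]))

lemma continuous_exp_neg_abs_rpow {α : ℝ} (hα : 0 < α) (κ : ℝ) :
    Continuous (fun θ : ℝ => Real.exp (-(κ * |θ| ^ α))) := by
  have : Continuous fun θ : ℝ => |θ| ^ α :=
    continuous_abs.rpow_const fun θ => Or.inr hα.le
  fun_prop

lemma integrable_exp_neg_abs_rpow {α κ : ℝ} (hα : 0 < α) (hκ : 0 < κ) :
    Integrable (fun θ : ℝ => Real.exp (-(κ * |θ| ^ α))) := by
  refine LocallyIntegrable.integrable_of_isBigO_atTop_of_norm_isNegInvariant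
    (g := fun θ : ℝ => Real.exp (-(κ * θ ^ α)))
    (continuous_exp_neg_abs_rpow hα κ).locallyIntegrable
    (Eventually.of_forall fun z => by simp) ?_
    ⟨Ioi 0, Ioi_mem_atTop 0, integrableOn_exp_neg_rpow hα hκ⟩
  refine EventuallyEq.isBigO ?_
  filter_upwards [eventually_gt_atTop 0] with θ hθ
  rw [abs_of_pos hθ]

lemma integral_eq_zero_of_odd {f : ℝ → ℝ} (hf : ∀ x, f (-x) = -f x) : ∫ x, f x = 0 := by
  have h := integral_neg_eq_self f volume
  simp only [hf, integral_neg] at h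
  linarith

lemma fourier_exp_neg_abs_rpow {α κ : ℝ} (hα : 0 < α) (hκ : 0 < κ) (w : ℝ) :
    FourierTransform.fourier (fun θ : ℝ => (Real.exp (-(κ * |θ| ^ α)) : ℂ)) w
      = ((2 * Real.pi * symStable α κ (2 * Real.pi * w) : ℝ) : ℂ) := by
  have hint := integrable_exp_neg_abs_rpow hα hκ
  have hc : Integrable fun θ : ℝ => Real.cos (2 * Real.pi * w * θ) *
      Real.exp (-(κ * |θ| ^ α)) :=
    hint.bdd_mul (c := 1) (by fun_prop) (Eventually.of_forall fun θ => Real.abs_cos_le_one _)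
  have hs : Integrable fun θ : ℝ => Real.sin (2 * Real.pi * w * θ) *
      Real.exp (-(κ * |θ| ^ α)) :=
    hint.bdd_mul (c := 1) (by fun_prop) (Eventually.of_forall fun θ => Real.abs_sin_le_one _)
  have h1 : ∫ θ : ℝ, Real.cos (2 * Real.pi * w * θ) * Real.exp (-(κ * |θ| ^ α)) =
      2 * Real.pi * symStable α κ (2 * Real.pi * w) := by
    have := integral_comp_abs (f := fun θ : ℝ => Real.cos (2 * Real.pi * w * θ) *
      Real.exp (-(κ * θ ^ α)))
    rw [symStable]
    field_simp
    rw [← this]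
    congr with θ
    rcases abs_choice θ with h | h <;> simp [h]
  have h2 : ∫ θ : ℝ, Real.sin (2 * Real.pi * w * θ) * Real.exp (-(κ * |θ| ^ α)) = 0 :=
    integral_eq_zero_of_odd fun θ => by simp
  rw [Real.fourier_eq']
  calc _ = ∫ θ : ℝ, (((Real.cos (2 * Real.pi * w * θ) * Real.exp (-(κ * |θ| ^ α)) : ℝ) : ℂ) -
        ((Real.sin (2 * Real.pi * w * θ) * Real.exp (-(κ * |θ| ^ α)) : ℝ) : ℂ) * Complex.I) := by
        congr with θ
        rw [Complex.exp_mul_I, ← Complex.ofReal_cos, ← Complex.ofReal_sin]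
        have : -2 * Real.pi * inner ℝ θ w = -(2 * Real.pi * w * θ) := by
          simp; ring
        rw [this, Real.cos_neg, Real.sin_neg, smul_eq_mul]
        push_cast
        ring
    _ = _ := by
        rw [integral_sub hc.ofReal (hs.ofReal.mul_const _), integral_mul_const,
          integral_complex_ofReal, integral_complex_ofReal, h1, h2]
        simp

/-- The characteristic function of the symmetric stable density. -/
lemma integral_symStable_mul_cos {α κ : ℝ} (hα : α ∈ Ioc (0:ℝ) 2) (hκ : 0 < κ) (θ : ℝ) :
    ∫ x, symStable α κ x * Real.cos (x * θ) = Real.exp (-(κ * |θ| ^ α)) := by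
  have hp := integrable_symStable hα hκ
  set f : ℝ → ℂ := fun θ : ℝ => (Real.exp (-(κ * |θ| ^ α)) : ℂ) with hf
  have hF : FourierTransform.fourier f = fun w : ℝ =>
      ((2 * Real.pi * symStable α κ (2 * Real.pi * w) : ℝ) : ℂ) :=
    funext fun w => fourier_exp_neg_abs_rpow hα.1 hκ w
  have hFint : Integrable (FourierTransform.fourier f) := by
    rw [hF]
    exact ((hp.comp_mul_left' (by positivity)).const_mul _).ofReal
  have hinv := congrFun (Continuous.fourierInv_fourier_eq (f := f)
    (Complex.continuous_ofReal.comp (continuous_exp_neg_abs_rpow hα.1 κ))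
    (integrable_exp_neg_abs_rpow hα.1 hκ).ofReal hFint) θ
  rw [Real.fourierInv_eq', hF] at hinv
  have hc : Integrable fun x => symStable α κ x * Real.cos (x * θ) :=
    hp.mul_bdd (c := 1) (by fun_prop) (Eventually.of_forall fun θ => Real.abs_cos_le_one _)
  have hs : Integrable fun x => symStable α κ x * Real.sin (x * θ) :=
    hp.mul_bdd (c := 1) (by fun_prop) (Eventually.of_forall fun θ => Real.abs_sin_le_one _)
  have h2 : ∫ x, symStable α κ x * Real.sin (x * θ) = 0 :=
    integral_eq_zero_of_odd fun x => by simp [symStable_neg]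
  have hsub := Measure.integral_comp_mul_left
    (fun x : ℝ => ((symStable α κ x * Real.cos (x * θ) : ℝ) : ℂ) +
      ((symStable α κ x * Real.sin (x * θ) : ℝ) : ℂ) * Complex.I) (2 * Real.pi)
  have hsum : ∫ x : ℝ, (((symStable α κ x * Real.cos (x * θ) : ℝ) : ℂ) +
      ((symStable α κ x * Real.sin (x * θ) : ℝ) : ℂ) * Complex.I) =
      ((∫ x, symStable α κ x * Real.cos (x * θ) : ℝ) : ℂ) + ((0 : ℝ) : ℂ) * Complex.I := by
    rw [integral_add hc.ofReal (hs.ofReal.mul_const _), integral_mul_const,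
      integral_complex_ofReal, integral_complex_ofReal, h2]
  rw [hsum, abs_of_pos (by positivity)] at hsub
  have hpi : (Real.pi : ℂ) ≠ 0 := by exact_mod_cast Real.pi_ne_zero
  rw [← Complex.ofReal_inj]
  change _ = f θ
  rw [← hinv]
  calc ((∫ x, symStable α κ x * Real.cos (x * θ) : ℝ) : ℂ)
      = 2 * Real.pi * ((2 * Real.pi)⁻¹ • (((∫ x, symStable α κ x * Real.cos (x * θ) : ℝ) : ℂ) +
          ((0 : ℝ) : ℂ) * Complex.I)) := by
        generalize ∫ x, symStable α κ x * Real.cos (x * θ) = A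
        simp
        field_simp
    _ = _ := by
        rw [← hsub, ← integral_const_mul]
        congr with v
        rw [Complex.exp_mul_I, ← Complex.ofReal_cos, ← Complex.ofReal_sin]
        have : 2 * Real.pi * inner ℝ v θ = 2 * Real.pi * v * θ := by
          simp; ring
        rw [this, smul_eq_mul]
        push_cast
        ring

/-- Chapman–Kolmogorov for the symmetric stable density. -/
lemma integral_symStable_mul_symStable_sub {α κ : ℝ} (hα : α ∈ Ioc (0:ℝ) 2) (hκ : 0 < κ)
    (w : ℝ) :
    ∫ x, symStable α κ x * symStable α κ (w - x) = symStable α (2 * κ) w := by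
  have hp := integrable_symStable hα hκ
  have hφ := integrableOn_exp_neg_rpow hα.1 hκ
  have hcos : ∀ θ, Integrable fun x => symStable α κ x * Real.cos (x * θ) := fun θ =>
    hp.mul_bdd (c := 1) (by fun_prop) (Eventually.of_forall fun θ => Real.abs_cos_le_one _)
  have hsin : ∀ θ, Integrable fun x => symStable α κ x * Real.sin (x * θ) := fun θ =>
    hp.mul_bdd (c := 1) (by fun_prop) (Eventually.of_forall fun θ => Real.abs_sin_le_one _)
  have hs0 : ∀ θ, ∫ x, symStable α κ x * Real.sin (x * θ) = 0 := fun θ =>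
    integral_eq_zero_of_odd fun x => by simp [symStable_neg]
  have hint : Integrable (Function.uncurry fun x θ : ℝ => Real.cos ((w - x) * θ) *
      (symStable α κ x * Real.exp (-(κ * θ ^ α)))) (volume.prod (volume.restrict (Ioi 0))) :=
    (hp.mul_prod hφ).bdd_mul (c := 1) (by fun_prop)
      (Eventually.of_forall fun θ => Real.abs_cos_le_one _)
  calc ∫ x, symStable α κ x * symStable α κ (w - x)
      = 1 / Real.pi * ∫ x, ∫ θ in Ioi (0:ℝ), Real.cos ((w - x) * θ) *
          (symStable α κ x * Real.exp (-(κ * θ ^ α))) := by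
        rw [← integral_const_mul]
        congr with x
        conv_lhs => rw [symStable.eq_def α κ (w - x)]
        rw [mul_left_comm, ← integral_const_mul]
        congr with θ
        ring
    _ = 1 / Real.pi * ∫ θ in Ioi (0:ℝ), ∫ x, Real.cos ((w - x) * θ) *
          (symStable α κ x * Real.exp (-(κ * θ ^ α))) := by
        rw [integral_integral_swap hint]
    _ = _ := by
        rw [symStable]
        congr 1
        refine setIntegral_congr_fun measurableSet_Ioi fun θ (hθ : 0 < θ) => ?_
        have : ∀ x, Real.cos ((w - x) * θ) * (symStable α κ x * Real.exp (-(κ * θ ^ α))) =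
            Real.cos (w * θ) * Real.exp (-(κ * θ ^ α)) * (symStable α κ x * Real.cos (x * θ)) +
            Real.sin (w * θ) * Real.exp (-(κ * θ ^ α)) *
              (symStable α κ x * Real.sin (x * θ)) := by
          intro x
          rw [sub_mul, Real.cos_sub]
          ring
        simp only [this]
        rw [integral_add ((hcos θ).const_mul _) ((hsin θ).const_mul _), integral_const_mul,
          integral_const_mul, hs0, integral_symStable_mul_cos hα hκ, abs_of_pos hθ, mul_zero,
          add_zero, mul_assoc, ← Real.exp_add]
        ring_nf

lemma integral_symStable {α κ : ℝ} (hα : α ∈ Ioc (0:ℝ) 2) (hκ : 0 < κ) :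
    ∫ x, symStable α κ x = 1 := by
  simpa [Real.zero_rpow hα.1.ne'] using integral_symStable_mul_cos hα hκ 0

/-- The stable probability of hitting `[0, L]` from `x`. -/
noncomputable def stableHit (α κ L x : ℝ) : ℝ := ∫ y in (0:ℝ)..L, symStable α κ (y - x)

lemma continuous_stableHit {α κ : ℝ} (hα : 0 < α) (hκ : 0 < κ) (L : ℝ) :
    Continuous (stableHit α κ L) := by
  have := continuous_symStable hα hκ
  exact intervalIntegral.continuous_parametric_intervalIntegral_of_continuous' (by fun_prop) _ _

lemma integrable_symStable_sub_prod {α κ : ℝ} (hα : α ∈ Ioc (0:ℝ) 2) (hκ : 0 < κ) (L : ℝ) :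
    Integrable (Function.uncurry fun x y : ℝ => symStable α κ (y - x))
      (volume.prod (volume.restrict (Ioc 0 L))) := by
  have hp := integrable_symStable hα hκ
  have hcont := continuous_symStable hα.1 hκ
  refine (integrable_prod_iff' (Continuous.aestronglyMeasurable (by fun_prop))).2 ⟨?_, ?_⟩
  · exact Eventually.of_forall fun y => hp.comp_sub_left y
  · have : ∀ y : ℝ, ∫ x, ‖symStable α κ (y - x)‖ = ∫ x, ‖symStable α κ x‖ := fun y =>
      integral_sub_left_eq_self (fun x => ‖symStable α κ x‖) volume y
    simp only [Function.uncurry_apply_pair, this]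
    exact integrable_const _

lemma integrable_stableHit {α κ L : ℝ} (hα : α ∈ Ioc (0:ℝ) 2) (hκ : 0 < κ) (hL : 0 ≤ L) :
    Integrable (stableHit α κ L) := by
  have := (integrable_symStable_sub_prod hα hκ L).integral_prod_left
  simp only [Function.uncurry_apply_pair, ← intervalIntegral.integral_of_le hL] at this
  exact this

lemma exists_abs_symStable_le {α κ : ℝ} (hα : 0 < α) (hκ : 0 < κ) :
    ∃ C, ∀ z, ‖symStable α κ z‖ ≤ C := by
  refine ⟨1 / Real.pi * ∫ θ in Ioi (0:ℝ), Real.exp (-(κ * θ ^ α)), fun z => ?_⟩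
  rw [symStable, norm_mul, Real.norm_of_nonneg (by positivity)]
  gcongr
  refine norm_integral_le_of_norm_le (integrableOn_exp_neg_rpow hα hκ)
    (Eventually.of_forall fun θ => ?_)
  rw [norm_mul, Real.norm_eq_abs, Real.norm_eq_abs, Real.abs_exp]
  exact mul_le_of_le_one_left (Real.exp_pos _).le (Real.abs_cos_le_one _)

lemma exists_abs_stableHit_le {α κ : ℝ} (hα : 0 < α) (hκ : 0 < κ) (L : ℝ) :
    ∃ C, ∀ x, ‖stableHit α κ L x‖ ≤ C := by
  obtain ⟨C, hC⟩ := exists_abs_symStable_le hα hκ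
  exact ⟨C * |L - 0|, fun x => intervalIntegral.norm_integral_le_of_norm_le_const
    fun y _ => hC _⟩

lemma integral_stableHit_mul {α κ L C : ℝ} (hα : α ∈ Ioc (0:ℝ) 2) (hκ : 0 < κ) (hL : 0 ≤ L)
    {g : ℝ → ℝ} (hg : Continuous g) (hC : ∀ x, ‖g x‖ ≤ C) :
    ∫ x, stableHit α κ L x * g x = ∫ y in (0:ℝ)..L, ∫ x, symStable α κ (y - x) * g x := by
  simp only [stableHit, intervalIntegral.integral_of_le hL, ← integral_mul_const]
  exact integral_integral_swap ((integrable_symStable_sub_prod hα hκ L).mul_bdd (c := C)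
    (Continuous.aestronglyMeasurable (by fun_prop)) (Eventually.of_forall fun q => hC q.1))

lemma integral_stableHit {α κ L : ℝ} (hα : α ∈ Ioc (0:ℝ) 2) (hκ : 0 < κ) (hL : 0 ≤ L) :
    ∫ x, stableHit α κ L x = L := by
  have h := integral_stableHit_mul hα hκ hL (g := fun _ => 1) continuous_const
    (C := 1) (by simp)
  simp only [mul_one] at h
  simp [h, integral_sub_left_eq_self (symStable α κ) volume, integral_symStable hα hκ]

lemma integral_stableHit_sq {α κ L : ℝ} (hα : α ∈ Ioc (0:ℝ) 2) (hκ : 0 < κ) (hL : 0 ≤ L) :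
    ∫ x, stableHit α κ L x * stableHit α κ L x =
      ∫ y in (0:ℝ)..L, ∫ y' in (0:ℝ)..L, symStable α (2 * κ) (y - y') := by
  obtain ⟨C, hC⟩ := exists_abs_symStable_le hα.1 hκ
  obtain ⟨D, hD⟩ := exists_abs_stableHit_le hα.1 hκ L
  have hcont := continuous_symStable hα.1 hκ
  rw [integral_stableHit_mul hα hκ hL (continuous_stableHit hα.1 hκ L) hD]
  congr with y
  simp only [mul_comm (symStable α κ _)]
  rw [integral_stableHit_mul hα hκ hL (g := fun x => symStable α κ (y - x)) (by fun_prop)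
    (fun x => hC _)]
  congr with y'
  rw [← integral_symStable_mul_symStable_sub hα hκ,
    ← integral_sub_left_eq_self (fun x => symStable α κ x * symStable α κ (y - y' - x)) volume y]
  congr with x
  rw [mul_comm, ← symStable_neg α κ (y' - x)]
  ring_nf

lemma intervalIntegral_integral_swap_of_le {L C : ℝ} (hL : 0 ≤ L) {w : ℝ → ℝ}
    (hw : IntegrableOn w (Ioi 0)) {k : ℝ → ℝ → ℝ} (hk : Measurable (Function.uncurry k))
    (hC : ∀ y, ∀ θ, ‖k y θ‖ ≤ C) :
    ∫ y in (0:ℝ)..L, ∫ θ in Ioi (0:ℝ), k y θ * w θ =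
      ∫ θ in Ioi (0:ℝ), (∫ y in (0:ℝ)..L, k y θ) * w θ := by
  simp only [intervalIntegral.integral_of_le hL, ← integral_mul_const]
  refine integral_integral_swap ?_
  have h1 : Integrable (fun _ : ℝ => (1:ℝ)) (volume.restrict (Ioc 0 L)) := integrable_const _
  have := (h1.mul_prod hw).bdd_mul (c := C) hk.aestronglyMeasurable
    (Eventually.of_forall fun q => hC q.1 q.2)
  simpa [Function.uncurry_def] using this

lemma integral_cos_sub_mul (L y : ℝ) {θ : ℝ} (hθ : θ ≠ 0) :
    ∫ x in (0:ℝ)..L, Real.cos ((y - x) * θ) =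
      (Real.sin (y * θ) - Real.sin ((y - L) * θ)) / θ := by
  have hd : ∀ x ∈ uIcc 0 L, HasDerivAt (fun x => -Real.sin ((y - x) * θ) / θ)
      (Real.cos ((y - x) * θ)) x := by
    intro x _
    refine ((((hasDerivAt_id x).const_sub y).mul_const θ).sin.neg.div_const θ).congr_deriv ?_
    simp [hθ]
  rw [intervalIntegral.integral_eq_sub_of_hasDerivAt hd
    (Continuous.intervalIntegrable (by fun_prop) _ _)]
  simp
  ring

lemma integral_integral_cos_sub_mul (L : ℝ) {θ : ℝ} (hθ : θ ≠ 0) :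
    ∫ y in (0:ℝ)..L, ∫ x in (0:ℝ)..L, Real.cos ((y - x) * θ) =
      2 * (1 - Real.cos (L * θ)) / θ ^ 2 := by
  simp only [integral_cos_sub_mul L _ hθ]
  have hd : ∀ x ∈ uIcc 0 L, HasDerivAt
      (fun x => (Real.cos ((x - L) * θ) - Real.cos (x * θ)) / θ ^ 2)
      ((Real.sin (x * θ) - Real.sin ((x - L) * θ)) / θ) x := by
    intro x _
    refine (((((hasDerivAt_id x).sub_const L).mul_const θ).cos.sub
      ((hasDerivAt_id x).mul_const θ).cos).div_const (θ ^ 2)).congr_deriv ?_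
    simp
    field_simp
    ring
  rw [intervalIntegral.integral_eq_sub_of_hasDerivAt hd
    (Continuous.intervalIntegrable (by fun_prop) _ _)]
  simp
  ring

lemma integral_integral_symStable_sub {α κ L : ℝ} (hα : 0 < α) (hκ : 0 < κ) (hL : 0 ≤ L) :
    ∫ y in (0:ℝ)..L, ∫ y' in (0:ℝ)..L, symStable α κ (y - y') =
      2 / Real.pi * ∫ θ in Ioi (0:ℝ),
        Real.exp (-(κ * θ ^ α)) * (1 - Real.cos (L * θ)) / θ ^ 2 := by
  have hw := integrableOn_exp_neg_rpow hα hκ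
  have hmeas : Measurable (Function.uncurry fun y θ : ℝ =>
      ∫ y' in (0:ℝ)..L, Real.cos ((y - y') * θ)) := by
    refine Continuous.measurable ?_
    exact intervalIntegral.continuous_parametric_intervalIntegral_of_continuous'
      (f := fun (q : ℝ × ℝ) y' => Real.cos ((q.1 - y') * q.2)) (by fun_prop) _ _
  have h1 : ∀ y : ℝ, ∫ y' in (0:ℝ)..L, symStable α κ (y - y') =
      1 / Real.pi * ∫ θ in Ioi (0:ℝ),
        (∫ y' in (0:ℝ)..L, Real.cos ((y - y') * θ)) * Real.exp (-(κ * θ ^ α)) := by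
    intro y
    simp only [symStable, intervalIntegral.integral_const_mul]
    rw [intervalIntegral_integral_swap_of_le (C := 1) hL hw
      (k := fun y' θ => Real.cos ((y - y') * θ)) (by fun_prop)
      fun _ _ => Real.abs_cos_le_one _]
  simp only [h1, intervalIntegral.integral_const_mul]
  rw [intervalIntegral_integral_swap_of_le (C := 1 * |L - 0|) hL hw hmeas
    fun y θ => intervalIntegral.norm_integral_le_of_norm_le_const
      fun _ _ => Real.abs_cos_le_one _]
  rw [div_eq_mul_one_div 2, mul_comm 2, mul_assoc, ← integral_const_mul 2]
  congr 1
  refine setIntegral_congr_fun measurableSet_Ioi fun θ (hθ : 0 < θ) => ?_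
  simp only [integral_integral_cos_sub_mul L hθ.ne']
  ring

theorem numVar_integral_formula (α c a t L : ℝ) (hα : α ∈ Set.Ioc (0:ℝ) 2)
    (hc : 0 < c) (ha : 0 < a) (ht : 0 < t) (hL : 0 < L) :
    (∑' j : ℤ, ∫ ε in (0:ℝ)..1,
        hitProb α c t a L j ε * (1 - hitProb α c t a L j ε)) =
      L / a + (2 / Real.pi) * ∫ θ in Set.Ioi (0:ℝ),
        Real.exp (-(2 * c * t * (θ / a) ^ α)) * (Real.cos (L * θ / a) - 1) / θ ^ 2 := by
  have hκ : 0 < c * t := mul_pos hc ht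
  set h := stableHit α (c * t) L with hh
  have hint : Integrable h := integrable_stableHit hα hκ hL.le
  have hcont : Continuous h := continuous_stableHit hα.1 hκ L
  obtain ⟨D, hD⟩ := exists_abs_stableHit_le hα.1 hκ L
  have hint2 : Integrable fun x => h x * h x :=
    hint.mul_bdd hcont.aestronglyMeasurable (Eventually.of_forall hD)
  have hG : Integrable fun x => h x * (1 - h x) := by
    simp only [mul_sub, mul_one]
    exact hint.sub hint2
  have hsum := (((hG.comp_mul_left' (neg_ne_zero.2 ha.ne')
    ).hasSum_intervalIntegral_comp_add_int).tsum_eq)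
  rw [Measure.integral_comp_mul_left (fun x => h x * (1 - h x))] at hsum
  have hval : ∫ x, h x * (1 - h x) = L - 2 / Real.pi * ∫ θ in Ioi (0:ℝ),
      Real.exp (-(2 * (c * t) * θ ^ α)) * (1 - Real.cos (L * θ)) / θ ^ 2 := by
    simp only [mul_sub, mul_one]
    rw [integral_sub hint hint2, integral_stableHit hα hκ hL.le,
      integral_stableHit_sq hα hκ hL.le,
      integral_integral_symStable_sub hα.1 (by positivity) hL.le]
    simp only [mul_sub, mul_one]
  have hscale := integral_comp_mul_left_Ioi (fun θ : ℝ =>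
    Real.exp (-(2 * (c * t) * θ ^ α)) * (1 - Real.cos (L * θ)) / θ ^ 2) 0 (inv_pos.2 ha)
  rw [mul_zero, smul_eq_mul, inv_inv] at hscale
  have hrhs : ∫ θ in Set.Ioi (0:ℝ),
        Real.exp (-(2 * c * t * (θ / a) ^ α)) * (Real.cos (L * θ / a) - 1) / θ ^ 2 =
      -(1 / a ^ 2) * ∫ θ in Ioi (0:ℝ), Real.exp (-(2 * (c * t) * (a⁻¹ * θ) ^ α)) *
        (1 - Real.cos (L * (a⁻¹ * θ))) / (a⁻¹ * θ) ^ 2 := by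
    rw [← integral_const_mul]
    congr with θ
    rw [show L * θ / a = L * (a⁻¹ * θ) by ring, show θ / a = a⁻¹ * θ by ring,
      show 2 * c * t = 2 * (c * t) by ring]
    field_simp
    ring
  rw [hrhs, hscale, ← Equiv.tsum_eq (Equiv.neg ℤ)]
  have hterm : ∀ (j : ℤ) (ε : ℝ), hitProb α c t a L (Equiv.neg ℤ j) ε = h (-a * (ε + j)) := by
    intro j ε
    simp only [hitProb, hh, stableHit, Equiv.neg_apply]
    push_cast
    rw [show a * (-(j:ℝ) - ε) = -a * (ε + j) by ring]
    rfl
  simp only [hterm]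
  rw [hsum, hval, inv_neg, abs_neg, abs_of_pos (inv_pos.2 ha), smul_eq_mul]
  field_simp
  ring
end

section
/- For every α ∈ (0,2], c > 0, a > 0 and fixed L > 0, the number variance tends to the Poisson value as time grows: lim_{t→∞} V_t^{α,c,a}[L] = L/a. -/
open MeasureTheory Filter Set

/-- The averaged number variance of the infinite system of independent symmetric
`α`-stable processes started from the equispaced-averaged configuration. -/
noncomputable def numVar (α c a t L : ℝ) : ℝ :=
  L / a + (2 / Real.pi) * ∫ θ in Set.Ioi (0:ℝ),
    Real.exp (-(2 * c * t * (θ / a) ^ α)) * (Real.cos (L * θ / a) - 1) / θ ^ 2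

theorem abs_cos_mul_sub_one_div_sq_le (k : ℝ) {θ : ℝ} (hθ : 0 < θ) :
    |(Real.cos (k * θ) - 1) / θ ^ 2| ≤ (k ^ 2 / 2 + 2) * (1 + θ ^ 2)⁻¹ := by
  have h₁ : 1 - Real.cos (k * θ) ≤ k ^ 2 / 2 * θ ^ 2 := by
    linarith [Real.one_sub_sq_div_two_le_cos (x := k * θ), mul_pow k θ 2]
  have h₂ : 1 - Real.cos (k * θ) ≤ 2 := by linarith [Real.neg_one_le_cos (k * θ)]
  rw [abs_div, abs_of_nonpos (sub_nonpos.2 (Real.cos_le_one _)), abs_of_pos (by positivity),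
    ← div_eq_mul_inv, div_le_div_iff₀ (by positivity) (by positivity)]
  linarith [mul_le_mul_of_nonneg_right h₂ (sq_nonneg θ)]

theorem tendsto_integral_exp_neg_mul_cos_sub_one_div_sq (α c a L : ℝ) (hc : 0 < c) (ha : 0 < a) :
    Tendsto (fun t : ℝ => ∫ θ in Set.Ioi (0:ℝ),
      Real.exp (-(2 * c * t * (θ / a) ^ α)) * (Real.cos (L * θ / a) - 1) / θ ^ 2)
      atTop (nhds 0) := by
  rw [show nhds (0:ℝ) = nhds (∫ _ in Set.Ioi (0:ℝ), (0:ℝ)) by simp]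
  refine tendsto_integral_filter_of_dominated_convergence
    (fun θ => ((L / a) ^ 2 / 2 + 2) * (1 + θ ^ 2)⁻¹) ?_ ?_ ?_ ?_
  · exact Eventually.of_forall fun t => Measurable.aestronglyMeasurable (by fun_prop)
  · filter_upwards [eventually_ge_atTop (0:ℝ)] with t ht
    filter_upwards [ae_restrict_mem measurableSet_Ioi] with θ (hθ : 0 < θ)
    rw [Real.norm_eq_abs, mul_div_assoc, abs_mul, Real.abs_exp, mul_div_right_comm]
    have hexp : Real.exp (-(2 * c * t * (θ / a) ^ α)) ≤ 1 :=
      Real.exp_le_one_iff.2 (neg_nonpos.2 (by positivity))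
    exact (mul_le_of_le_one_left (abs_nonneg _) hexp).trans
      (abs_cos_mul_sub_one_div_sq_le (L / a) hθ)
  · exact (integrable_inv_one_add_sq.const_mul _).integrableOn
  · filter_upwards [ae_restrict_mem measurableSet_Ioi] with θ (hθ : 0 < θ)
    have hpos : 0 < (θ / a) ^ α := by positivity
    have harg : Tendsto (fun t : ℝ => 2 * c * t * (θ / a) ^ α) atTop atTop :=
      (tendsto_id.const_mul_atTop (by positivity : 0 < 2 * c)).atTop_mul_const hpos
    simpa using ((Real.tendsto_exp_neg_atTop_nhds_zero.comp harg).mul_const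
      (Real.cos (L * θ / a) - 1)).div_const (θ ^ 2)

theorem numVar_large_time_poisson (α c a L : ℝ) (hα : α ∈ Set.Ioc (0:ℝ) 2)
    (hc : 0 < c) (ha : 0 < a) (hL : 0 < L) :
    Tendsto (fun t : ℝ => numVar α c a t L) atTop (nhds (L / a)) := by
  simpa [numVar] using
    ((tendsto_integral_exp_neg_mul_cos_sub_one_div_sq α c a L hc ha).const_mul
      (2 / Real.pi)).const_add (L / a)
end

section
/- For every α ∈ (0,2], c > 0 and a > 0, the function f^{α,c,a} is concave on [0,∞); consequently, for all s, r, u ≥ 0 one has f^{α,c,a}(s+r+u) + f^{α,c,a}(u) ≤ f^{α,c,a}(s+u) + f^{α,c,a}(r+u), i.e. the increments of the limiting Gaussian process G^{α,c,a} are negatively correlated. -/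
open MeasureTheory Filter Set

/-- The limiting variance function of the fluctuation process (`fVar α c a 0 = 0`). -/
noncomputable def fVar (α c a s : ℝ) : ℝ :=
  (4 * s / (a * Real.pi)) * ∫ u in Set.Ioi (0:ℝ),
    Real.sin (u / 2) ^ 2 * (1 - Real.exp (-(2 * c * (u / s) ^ α))) / u ^ 2

open Topology ProbabilityTheory

theorem integrableOn_one_sub_cos_div_sq (s : ℝ) :
    IntegrableOn (fun v : ℝ ↦ (1 - Real.cos (s * v)) / v ^ 2) (Ioi 0) := by
  refine Integrable.mono' (integrable_inv_one_add_sq.const_mul (2 + s ^ 2 / 2)).integrableOn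
    (Measurable.aestronglyMeasurable (by fun_prop)) ((ae_restrict_mem measurableSet_Ioi).mono fun v hv ↦ ?_)
  have hv : 0 < v := hv
  have h₁ := Real.one_sub_sq_div_two_le_cos (x := s * v)
  have h₂ := Real.neg_one_le_cos (s * v)
  have h₃ := Real.cos_le_one (s * v)
  rw [Real.norm_of_nonneg (div_nonneg (by linarith) (by positivity)), ← div_eq_mul_inv,
    div_le_div_iff₀ (by positivity) (by positivity)]
  nlinarith [mul_nonneg (sub_nonneg.2 h₂) (sq_nonneg v)]

theorem integral_one_sub_cos_div_sq (s : ℝ) :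
    ∫ v in Ioi (0 : ℝ), (1 - Real.cos (s * v)) / v ^ 2 =
      |s| * ∫ v in Ioi (0 : ℝ), (1 - Real.cos v) / v ^ 2 := by
  rcases eq_or_ne s 0 with rfl | hs
  · simp
  have hs' : 0 < |s| := abs_pos.2 hs
  have key := integral_comp_mul_left_Ioi (fun v : ℝ ↦ (1 - Real.cos v) / v ^ 2) 0 hs'
  rw [mul_zero, smul_eq_mul, inv_mul_eq_div, eq_div_iff hs'.ne'] at key
  rw [← key, mul_comm |s|, mul_assoc, ← integral_mul_const]
  refine setIntegral_congr_fun measurableSet_Ioi fun v hv ↦ ?_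
  have hv : 0 < v := hv
  have hcos : Real.cos (|s| * v) = Real.cos (s * v) := by
    rw [← Real.cos_abs (s * v), abs_mul, abs_of_pos hv]
  simp only [hcos]
  field_simp

theorem integral_one_sub_cos_mul_one_sub_cos_div_sq (s x : ℝ) :
    ∫ v in Ioi (0 : ℝ), (1 - Real.cos (s * v)) * (1 - Real.cos (x * v)) / v ^ 2 =
      (∫ v in Ioi (0 : ℝ), (1 - Real.cos v) / v ^ 2) *
        (|s| + |x| - |s + x| / 2 - |s - x| / 2) := by
  have hsplit : ∀ v : ℝ, (1 - Real.cos (s * v)) * (1 - Real.cos (x * v)) / v ^ 2 =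
      (1 - Real.cos (s * v)) / v ^ 2 + (1 - Real.cos (x * v)) / v ^ 2
        - (1 - Real.cos ((s + x) * v)) / v ^ 2 / 2 - (1 - Real.cos ((s - x) * v)) / v ^ 2 / 2 := by
    intro v
    rw [add_mul s, sub_mul s, Real.cos_add, Real.cos_sub]
    ring
  have hi := integrableOn_one_sub_cos_div_sq
  simp_rw [hsplit]
  rw [integral_sub (by exact ((hi s).add (hi x)).sub ((hi (s + x)).div_const 2)) ((hi (s - x)).div_const 2),
    integral_sub (by exact (hi s).add (hi x)) ((hi (s + x)).div_const 2),
    integral_add (hi s) (hi x), integral_div, integral_div]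
  simp_rw [integral_one_sub_cos_div_sq]
  ring

theorem concaveOn_abs_add_abs_sub (x : ℝ) :
    ConcaveOn ℝ (Ici 0) fun s : ℝ ↦ |s| + |x| - |s + x| / 2 - |s - x| / 2 := by
  refine ⟨convex_Ici 0, fun s hs t ht p q hp hq hpq ↦ ?_⟩
  have hs : 0 ≤ s := hs
  have ht : 0 ≤ t := ht
  have key : ∀ y : ℝ, |p * s + q * t + y| ≤ p * |s + y| + q * |t + y| := by
    intro y
    have hy : p * s + q * t + y = p * (s + y) + q * (t + y) := by linear_combination -y * hpq
    rw [hy]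
    refine (abs_add_le _ _).trans_eq ?_
    rw [abs_mul, abs_mul, abs_of_nonneg hp, abs_of_nonneg hq]
  have h₁ := key x
  have h₂ := key (-x)
  simp only [smul_eq_mul, ← sub_eq_add_neg] at *
  rw [abs_of_nonneg hs, abs_of_nonneg ht,
    abs_of_nonneg (add_nonneg (mul_nonneg hp hs) (mul_nonneg hq ht))]
  have hx : p * |x| + q * |x| = |x| := by rw [← add_mul, hpq, one_mul]
  linarith

/-- The integral transform `s ↦ ∫₀^∞ (1 - cos (s v)) (1 - φ v) v⁻² dv`. -/
noncomputable def cosTransform (φ : ℝ → ℝ) (s : ℝ) : ℝ :=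
  ∫ v in Ioi (0 : ℝ), (1 - Real.cos (s * v)) * (1 - φ v) / v ^ 2

/-- A real function that is the characteristic function of a probability measure on `ℝ`. -/
def IsRealCharFun (φ : ℝ → ℝ) : Prop :=
  ∃ μ : Measure ℝ, IsProbabilityMeasure μ ∧ ∀ t, charFun μ t = φ t

theorem re_charFun_eq_integral_cos (μ : Measure ℝ) [IsProbabilityMeasure μ] (t : ℝ) :
    (charFun μ t).re = ∫ x, Real.cos (x * t) ∂μ := by
  rw [charFun_apply_real]
  have hi : Integrable (fun x : ℝ ↦ Complex.exp (t * x * Complex.I)) μ :=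
    Integrable.of_bound (by fun_prop) 1 (ae_of_all _ fun x ↦ by
      rw [← Complex.ofReal_mul, Complex.norm_exp_ofReal_mul_I])
  refine (integral_re hi).symm.trans (integral_congr_ae (ae_of_all _ fun x ↦ ?_))
  simp only [← Complex.ofReal_mul]
  rw [mul_comm x t]
  exact Complex.exp_ofReal_mul_I_re _

theorem cosTransform_integral_cos (μ : Measure ℝ) [IsProbabilityMeasure μ] (s : ℝ) :
    let g : ℝ → ℝ := fun x ↦ (∫ v in Ioi (0 : ℝ), (1 - Real.cos v) / v ^ 2) *
        (|s| + |x| - |s + x| / 2 - |s - x| / 2)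
    Integrable g μ ∧ cosTransform (fun v ↦ ∫ x, Real.cos (x * v) ∂μ) s = ∫ x, g x ∂μ := by
  intro g
  have hprod : Integrable (fun z : ℝ × ℝ ↦
      (1 - Real.cos (s * z.2)) * (1 - Real.cos (z.1 * z.2)) / z.2 ^ 2)
      (μ.prod (volume.restrict (Ioi 0))) := by
    refine Integrable.mono' ((integrableOn_one_sub_cos_div_sq s).comp_snd μ |>.const_mul 2)
      (Measurable.aestronglyMeasurable (by fun_prop)) (ae_of_all _ fun z ↦ ?_)
    have h₁ := Real.cos_le_one (s * z.2)
    have h₂ := Real.cos_le_one (z.1 * z.2)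
    have h₃ := Real.neg_one_le_cos (z.1 * z.2)
    rw [Real.norm_of_nonneg (div_nonneg (mul_nonneg (by linarith) (by linarith)) (by positivity)),
      ← mul_div_assoc]
    refine div_le_div_of_nonneg_right ?_ (sq_nonneg _)
    nlinarith
  have hg : ∀ x, ∫ v in Ioi (0 : ℝ), (1 - Real.cos (s * v)) * (1 - Real.cos (x * v)) / v ^ 2 =
      g x := integral_one_sub_cos_mul_one_sub_cos_div_sq s
  refine ⟨by simpa only [hg] using hprod.integral_prod_left, ?_⟩
  have hswap := integral_integral_swap (f := fun x v : ℝ ↦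
    (1 - Real.cos (s * v)) * (1 - Real.cos (x * v)) / v ^ 2) hprod
  simp only [hg] at hswap
  rw [hswap]
  refine integral_congr_ae (ae_of_all _ fun v ↦ ?_)
  have hc : Integrable (fun x ↦ Real.cos (x * v)) μ :=
    Integrable.of_bound (by fun_prop) 1 (ae_of_all _ fun x ↦ Real.abs_cos_le_one _)
  simp only [integral_div, integral_const_mul]
  rw [integral_sub (integrable_const 1) hc]
  simp

theorem IsRealCharFun.concaveOn_cosTransform {φ : ℝ → ℝ} (hφ : IsRealCharFun φ) :
    ConcaveOn ℝ (Ici 0) (cosTransform φ) := by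
  obtain ⟨μ, hμ, h⟩ := hφ
  have hφ' : φ = fun v ↦ ∫ x, Real.cos (x * v) ∂μ := by
    ext v
    rw [← re_charFun_eq_integral_cos, h, Complex.ofReal_re]
  have hnn : 0 ≤ ∫ v in Ioi (0 : ℝ), (1 - Real.cos v) / v ^ 2 :=
    integral_nonneg fun v ↦ div_nonneg (sub_nonneg.2 (Real.cos_le_one v)) (sq_nonneg v)
  rw [hφ']
  refine ⟨convex_Ici 0, fun s hs t ht p q hp hq hpq ↦ ?_⟩
  obtain ⟨is, es⟩ := cosTransform_integral_cos μ s
  obtain ⟨it, et⟩ := cosTransform_integral_cos μ t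
  obtain ⟨ir, er⟩ := cosTransform_integral_cos μ (p • s + q • t)
  rw [es, et, er, ← integral_smul, ← integral_smul, ← integral_add (by exact is.smul p)
    (by exact it.smul q)]
  exact integral_mono ((is.smul p).add (it.smul q)) ir fun x ↦
    ((concaveOn_abs_add_abs_sub x).smul hnn).2 hs ht hp hq hpq

theorem concaveOn_cosTransform_of_tendsto {φ : ℕ → ℝ → ℝ} {ψ : ℝ → ℝ}
    (hφ : ∀ n, IsRealCharFun (φ n))
    (hlim : ∀ v, 0 < v → Tendsto (fun n ↦ φ n v) atTop (𝓝 (ψ v))) :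
    ConcaveOn ℝ (Ici 0) (cosTransform ψ) := by
  have htend : ∀ s, Tendsto (fun n ↦ cosTransform (φ n) s) atTop (𝓝 (cosTransform ψ s)) := by
    intro s
    refine tendsto_integral_of_dominated_convergence
      (fun v ↦ 2 * ((1 - Real.cos (s * v)) / v ^ 2)) (fun n ↦ ?_)
      ((integrableOn_one_sub_cos_div_sq s).const_mul 2) (fun n ↦ ?_) ?_
    · obtain ⟨μ, hμ, h⟩ := hφ n
      have hφ' : φ n = fun v ↦ (charFun μ v).re := by
        ext v
        rw [h, Complex.ofReal_re]
      have : Measurable (φ n) := hφ' ▸ Complex.measurable_re.comp measurable_charFun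
      exact Measurable.aestronglyMeasurable (by fun_prop)
    · obtain ⟨μ, hμ, h⟩ := hφ n
      refine ae_of_all _ fun v ↦ ?_
      have hb : |φ n v| ≤ 1 := by
        simpa [h] using norm_charFun_le_one (μ := μ) v
      have h₁ := Real.cos_le_one (s * v)
      have h₂ := abs_le.1 hb
      rw [Real.norm_of_nonneg (div_nonneg (mul_nonneg (by linarith) (by linarith))
        (by positivity)), ← mul_div_assoc]
      refine div_le_div_of_nonneg_right ?_ (sq_nonneg _)
      nlinarith
    · filter_upwards [ae_restrict_mem measurableSet_Ioi] with v hv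
      exact ((hlim v hv).const_sub 1 |>.const_mul _).div_const _
  refine ⟨convex_Ici 0, fun s hs t ht p q hp hq hpq ↦ ?_⟩
  exact le_of_tendsto_of_tendsto' (((htend s).const_smul p).add ((htend t).const_smul q))
    (htend _) fun n ↦ (hφ n).concaveOn_cosTransform.2 hs ht hp hq hpq

theorem isRealCharFun_one : IsRealCharFun fun _ ↦ 1 :=
  ⟨Measure.dirac 0, inferInstance, fun t ↦ by simp⟩

theorem IsRealCharFun.mul {φ ψ : ℝ → ℝ} (hφ : IsRealCharFun φ) (hψ : IsRealCharFun ψ) :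
    IsRealCharFun fun t ↦ φ t * ψ t := by
  obtain ⟨μ, hμ, h⟩ := hφ
  obtain ⟨ν, hν, k⟩ := hψ
  exact ⟨μ.conv ν, inferInstance, fun t ↦ by rw [charFun_conv, h, k, Complex.ofReal_mul]⟩

theorem IsRealCharFun.pow {φ : ℝ → ℝ} (hφ : IsRealCharFun φ) (n : ℕ) :
    IsRealCharFun fun t ↦ φ t ^ n := by
  induction n with
  | zero => simpa using isRealCharFun_one
  | succ n ih => simpa only [pow_succ] using ih.mul hφ

/-- The symmetrization of a law with itself reflected has characteristic function the real part. -/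
theorem isRealCharFun_integral_cos (μ : Measure ℝ) [IsProbabilityMeasure μ] :
    IsRealCharFun fun t ↦ ∫ x, Real.cos (x * t) ∂μ := by
  have hν : IsProbabilityMeasure (μ.map (-1 * ·)) :=
    Measure.isProbabilityMeasure_map (by fun_prop)
  refine ⟨(2⁻¹ : ENNReal) • (μ + μ.map (-1 * ·)), ⟨?_⟩, fun t ↦ ?_⟩
  · simp only [Measure.smul_apply, Measure.add_apply, measure_univ, smul_eq_mul]
    rw [one_add_one_eq_two]
    exact ENNReal.inv_mul_cancel (by simp) (by simp)
  · beta_reduce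
    have hi : ∀ ν : Measure ℝ, IsProbabilityMeasure ν →
        Integrable (fun x : ℝ ↦ Complex.exp (t * x * Complex.I)) ν := fun ν _ ↦
      Integrable.of_bound (by fun_prop) 1 (ae_of_all _ fun x ↦ by
        rw [← Complex.ofReal_mul, Complex.norm_exp_ofReal_mul_I])
    rw [← re_charFun_eq_integral_cos, charFun_apply_real, integral_smul_measure,
      integral_add_measure (hi _ ‹_›) (hi _ hν), ← charFun_apply_real, ← charFun_apply_real,
      charFun_map_mul, neg_one_mul, charFun_neg, Complex.add_conj]
    simp

theorem integrableOn_one_sub_cos_mul_rpow {α : ℝ} (h0 : 0 < α) (h2 : α < 2) (s : ℝ) :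
    IntegrableOn (fun v : ℝ ↦ (1 - Real.cos (s * v)) * v ^ (-(α + 1))) (Ioi 0) := by
  rw [← Ioc_union_Ioi_eq_Ioi zero_le_one, integrableOn_union]
  have hm : Measurable fun v : ℝ ↦ (1 - Real.cos (s * v)) * v ^ (-(α + 1)) := by fun_prop
  constructor
  · have hi : IntegrableOn (fun v : ℝ ↦ s ^ 2 / 2 * v ^ (1 - α)) (Ioc 0 1) :=
      (((intervalIntegral.intervalIntegrable_rpow' (by linarith)).1).const_mul _)
    refine Integrable.mono' hi hm.aestronglyMeasurable
      ((ae_restrict_mem measurableSet_Ioc).mono fun v hv ↦ ?_)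
    have hv : 0 < v := hv.1
    have h₁ := Real.one_sub_sq_div_two_le_cos (x := s * v)
    have h₃ := Real.cos_le_one (s * v)
    rw [Real.norm_of_nonneg (mul_nonneg (by linarith) (by positivity)),
      show 1 - α = 2 + -(α + 1) by ring, Real.rpow_add hv, Real.rpow_two, ← mul_assoc]
    gcongr
    linarith
  · refine Integrable.mono' ((integrableOn_Ioi_rpow_of_lt (a := -(α + 1)) (by linarith) one_pos).const_mul 2)
      hm.aestronglyMeasurable ((ae_restrict_mem measurableSet_Ioi).mono fun v hv ↦ ?_)
    have hv : 0 < v := one_pos.trans hv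
    have h₂ := Real.neg_one_le_cos (s * v)
    have h₃ := Real.cos_le_one (s * v)
    rw [Real.norm_of_nonneg (mul_nonneg (by linarith) (by positivity))]
    gcongr
    linarith

theorem integral_one_sub_cos_mul_rpow (α : ℝ) {s : ℝ} (hs : 0 < s) :
    ∫ v in Ioi (0 : ℝ), (1 - Real.cos (s * v)) * v ^ (-(α + 1)) =
      s ^ α * ∫ v in Ioi (0 : ℝ), (1 - Real.cos v) * v ^ (-(α + 1)) := by
  have key := integral_comp_mul_left_Ioi
    (fun v : ℝ ↦ (1 - Real.cos v) * v ^ (-(α + 1))) 0 hs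
  rw [mul_zero, smul_eq_mul, inv_mul_eq_div, eq_div_iff hs.ne'] at key
  rw [← key, ← integral_mul_const, ← integral_const_mul]
  refine setIntegral_congr_fun measurableSet_Ioi fun v hv ↦ ?_
  have hv : 0 < v := hv
  have h : s ^ α * s ^ (-(α + 1)) * s = 1 := by
    rw [← Real.rpow_add hs, ← Real.rpow_add_one hs.ne']
    simp
  rw [Real.mul_rpow hs.le hv.le]
  linear_combination -((1 - Real.cos (s * v)) * v ^ (-(α + 1))) * h

theorem integral_one_sub_cos_mul_rpow_pos {α : ℝ} (h0 : 0 < α) (h2 : α < 2) :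
    0 < ∫ v in Ioi (0 : ℝ), (1 - Real.cos v) * v ^ (-(α + 1)) := by
  have hi : IntegrableOn (fun v : ℝ ↦ (1 - Real.cos v) * v ^ (-(α + 1))) (Ioi 0) := by
    simpa using integrableOn_one_sub_cos_mul_rpow h0 h2 1
  rw [setIntegral_pos_iff_support_of_nonneg_ae ?_ hi]
  · have hsub : Ioo (0 : ℝ) 1 ⊆
        Function.support (fun v : ℝ ↦ (1 - Real.cos v) * v ^ (-(α + 1))) ∩ Ioi 0 := by
      intro v hv
      refine ⟨mul_ne_zero ?_ (Real.rpow_pos_of_pos hv.1 _).ne', hv.1⟩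
      have := Real.cos_lt_cos_of_nonneg_of_le_pi le_rfl (by linarith [hv.2, Real.pi_gt_three]) hv.1
      rw [Real.cos_zero] at this
      linarith
    exact lt_of_lt_of_le (by simp) (measure_mono hsub)
  · filter_upwards [ae_restrict_mem measurableSet_Ioi] with v hv
    have hv : 0 < v := hv
    exact mul_nonneg (sub_nonneg.2 (Real.cos_le_one v)) (by positivity)

theorem integral_cos_paretoMeasure {α t : ℝ} (hα : 0 < α) (ht : 0 < t) (v : ℝ) :
    ∫ x, Real.cos (x * v) ∂paretoMeasure t α =
      1 + -(α * t ^ α * ∫ x in Ioi t, (1 - Real.cos (v * x)) * x ^ (-(α + 1))) := by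
  have := isProbabilityMeasure_paretoMeasure ht hα
  have hc : Integrable (fun x ↦ Real.cos (x * v)) (paretoMeasure t α) :=
    Integrable.of_bound (by fun_prop) 1 (ae_of_all _ fun x ↦ Real.abs_cos_le_one _)
  have key : ∫ x, (1 - Real.cos (x * v)) ∂paretoMeasure t α =
      α * t ^ α * ∫ x in Ioi t, (1 - Real.cos (v * x)) * x ^ (-(α + 1)) := by
    rw [paretoMeasure, integral_withDensity_eq_integral_toReal_smul
      (show Measurable (paretoPDF t α) from (measurable_paretoPDFReal t α).ennreal_ofReal) (ae_of_all _ fun _ ↦ ENNReal.ofReal_lt_top),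
      ← integral_const_mul, ← integral_Ici_eq_integral_Ioi, ← integral_indicator measurableSet_Ici]
    refine integral_congr_ae (ae_of_all _ fun x ↦ ?_)
    simp only [paretoPDF, ENNReal.toReal_ofReal (paretoPDFReal_nonneg ht.le hα.le x)]
    simp only [paretoPDFReal, indicator, mem_Ici, smul_eq_mul]
    split_ifs
    · rw [mul_comm v]; ring
    · simp
  rw [integral_sub (integrable_const 1) hc] at key
  simp only [integral_const, probReal_univ, smul_eq_mul, one_mul] at key
  linarith

/-- Rescaled sums of symmetrized Pareto variables approximate a symmetric stable law. -/
theorem exists_isRealCharFun_tendsto_exp_neg_rpow {α b : ℝ} (hα : α ∈ Ioc (0 : ℝ) 2)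
    (hb : 0 < b) :
    ∃ φ : ℕ → ℝ → ℝ, (∀ n, IsRealCharFun (φ n)) ∧
      ∀ v, 0 < v → Tendsto (fun n ↦ φ n v) atTop (𝓝 (Real.exp (-(b * v ^ α)))) := by
  rcases hα.2.eq_or_lt with rfl | h2
  · refine ⟨fun _ v ↦ Real.exp (-(b * v ^ (2 : ℝ))),
      fun _ ↦ ⟨gaussianReal 0 (2 * b).toNNReal, inferInstance, fun t ↦ ?_⟩,
      fun v _ ↦ tendsto_const_nhds⟩
    rw [charFun_gaussianReal, Complex.ofReal_exp, Real.rpow_two, Real.coe_toNNReal _ (by positivity)]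
    congr 1
    push_cast
    ring
  have h0 : 0 < α := hα.1
  set K := ∫ v in Ioi (0 : ℝ), (1 - Real.cos v) * v ^ (-(α + 1))
  have hKpos : 0 < K := integral_one_sub_cos_mul_rpow_pos h0 h2
  set C := b / (α * K) with hC
  have hCpos : 0 < C := by positivity
  let t : ℕ → ℝ := fun n ↦ (C / (n + 1)) ^ α⁻¹
  have htpos : ∀ n, 0 < t n := fun n ↦ by positivity
  have htα : ∀ n, t n ^ α = C / (n + 1) := fun n ↦
    Real.rpow_inv_rpow (by positivity) h0.ne'
  have hdiv : Tendsto (fun n : ℕ ↦ C / ((n : ℝ) + 1)) atTop (𝓝 0) := by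
    simpa only [mul_one_div, mul_zero] using
      tendsto_one_div_add_atTop_nhds_zero_nat (𝕜 := ℝ) |>.const_mul C
  have ht0 : Tendsto t atTop (𝓝 0) := by
    simpa [Real.zero_rpow (inv_ne_zero h0.ne')] using
      hdiv.rpow_const (p := α⁻¹) (Or.inr (by positivity))
  refine ⟨fun n v ↦ (∫ x, Real.cos (x * v) ∂paretoMeasure (t n) α) ^ n, fun n ↦ ?_,
    fun v hv ↦ ?_⟩
  · have := isProbabilityMeasure_paretoMeasure (htpos n) h0
    exact (isRealCharFun_integral_cos _).pow n
  simp_rw [fun n ↦ integral_cos_paretoMeasure h0 (htpos n) v]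
  refine Real.tendsto_one_add_pow_exp_of_tendsto ?_
  have hJ : Tendsto (fun n ↦ ∫ x in Ioi (t n), (1 - Real.cos (v * x)) * x ^ (-(α + 1))) atTop
      (𝓝 (v ^ α * K)) := by
    rw [← integral_one_sub_cos_mul_rpow α hv]
    refine ((aecover_Ioi_of_Ioi ht0).integral_tendsto_of_countably_generated
      (integrableOn_one_sub_cos_mul_rpow h0 h2 v)).congr fun n ↦ ?_
    rw [Measure.restrict_restrict measurableSet_Ioi,
      inter_eq_left.2 (Ioi_subset_Ioi (htpos n).le)]
  have hn : Tendsto (fun n : ℕ ↦ (n : ℝ) / (n + 1)) atTop (𝓝 1) :=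
    tendsto_natCast_div_add_atTop 1
  have hlim := ((hn.mul hJ).const_mul (-(α * C)))
  have hval : -(α * C) * (1 * (v ^ α * K)) = -(b * v ^ α) := by
    rw [hC]
    field_simp
  rw [hval] at hlim
  refine hlim.congr fun n ↦ ?_
  rw [htα]
  ring

theorem fVar_eq_cosTransform (α c a : ℝ) {s : ℝ} (hs : 0 ≤ s) :
    fVar α c a s =
      2 / (a * Real.pi) * cosTransform (fun v ↦ Real.exp (-(2 * c * v ^ α))) s := by
  rcases hs.eq_or_lt with rfl | hs
  · simp [fVar, cosTransform]
  have key := integral_comp_mul_left_Ioi (fun u : ℝ ↦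
    Real.sin (u / 2) ^ 2 * (1 - Real.exp (-(2 * c * (u / s) ^ α))) / u ^ 2) 0 hs
  rw [mul_zero, smul_eq_mul, inv_mul_eq_div, eq_div_iff hs.ne'] at key
  rw [fVar, cosTransform, ← key, ← integral_mul_const, ← integral_const_mul, ← integral_const_mul]
  refine setIntegral_congr_fun measurableSet_Ioi fun v hv ↦ ?_
  have hv : 0 < v := hv
  rw [Real.sin_sq_eq_half_sub, mul_div_cancel_left₀ v hs.ne', mul_div_cancel₀ (s * v) two_ne_zero]
  field_simp
  ring

/-- A concave function on `[0, ∞)` has decreasing increments. -/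
theorem ConcaveOn.add_le_add_of_nonneg {f : ℝ → ℝ} (hf : ConcaveOn ℝ (Ici 0) f) {s r u : ℝ}
    (hs : 0 ≤ s) (hr : 0 ≤ r) (hu : 0 ≤ u) : f (s + r + u) + f u ≤ f (s + u) + f (r + u) := by
  rcases (add_nonneg hs hr).eq_or_lt with h | h
  · obtain ⟨rfl, rfl⟩ : s = 0 ∧ r = 0 := ⟨by linarith, by linarith⟩
    simp
  have hmem : s + r + u ∈ Ici (0 : ℝ) := by simp only [mem_Ici]; positivity
  have key : ∀ p q, 0 ≤ p → 0 ≤ q → p + q = s + r →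
      p / (s + r) * f (s + r + u) + q / (s + r) * f u ≤ f (p + u) := by
    intro p q hp hq hpq
    have := hf.2 hmem (mem_Ici.2 hu) (div_nonneg hp h.le) (div_nonneg hq h.le)
      (by rw [← add_div, hpq, div_self h.ne'])
    simp only [smul_eq_mul] at this
    have hpt : p / (s + r) * (s + r + u) + q / (s + r) * u = p + u := by
      rw [div_mul_eq_mul_div, div_mul_eq_mul_div, ← add_div, div_eq_iff h.ne']
      linear_combination u * hpq
    rwa [hpt] at this
  have h₁ := key s r hs hr rfl
  have h₂ := key r s hr hs (add_comm r s)
  have h₃ : s / (s + r) + r / (s + r) = 1 := by rw [← add_div, div_self h.ne']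
  linear_combination h₁ + h₂ + (-f (s + r + u) - f u) * h₃

theorem fVar_concave_and_increments_negatively_correlated (α c a : ℝ)
    (hα : α ∈ Set.Ioc (0:ℝ) 2) (hc : 0 < c) (ha : 0 < a) :
    ConcaveOn ℝ (Set.Ici 0) (fVar α c a) ∧
      ∀ s r u : ℝ, 0 ≤ s → 0 ≤ r → 0 ≤ u →
        fVar α c a (s + r + u) + fVar α c a u ≤
          fVar α c a (s + u) + fVar α c a (r + u) := by
  have hconc : ConcaveOn ℝ (Ici 0) (fVar α c a) := by
    obtain ⟨φ, hφ, hlim⟩ := exists_isRealCharFun_tendsto_exp_neg_rpow hα (mul_pos two_pos hc)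
    exact ((concaveOn_cosTransform_of_tendsto hφ hlim).smul
      (show 0 ≤ 2 / (a * Real.pi) by positivity)).congr
        fun s hs ↦ (fVar_eq_cosTransform α c a hs).symm
  exact ⟨hconc, fun s r u ↦ hconc.add_le_add_of_nonneg⟩
end

section
/- (Long-range dependence) For every α ∈ (0,2), c > 0, a > 0 and fixed s, r > 0, there exists a nonzero constant k (depending on α, c, a, s, r) such that lim_{u→∞} u^{α+1} ( f^{α,c,a}(s+r+u) − f^{α,c,a}(r+u) − f^{α,c,a}(s+u) + f^{α,c,a}(u) ) = k; that is, the covariance between increments of the limiting Gaussian process G^{α,c,a} separated by a gap u decays like a power law u^{-(α+1)}. -/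
open MeasureTheory Filter Set

theorem integral_Ioi_zero_eq_integral_exp {E : Type*} [NormedAddCommGroup E] [NormedSpace ℝ E]
    (g : ℝ → E) : ∫ x in Ioi (0:ℝ), g x = ∫ y, Real.exp y • g (Real.exp y) := by
  have h := integral_image_eq_integral_abs_deriv_smul (MeasurableSet.univ)
    (fun x _ => (Real.hasDerivAt_exp x).hasDerivWithinAt)
    (fun x _ y _ hxy => Real.exp_injective hxy) g
  simpa [Real.range_exp, abs_of_pos (Real.exp_pos _)] using h

theorem integrableOn_Ioi_zero_iff_integrable_exp {E : Type*} [NormedAddCommGroup E]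
    [NormedSpace ℝ E] (g : ℝ → E) :
    IntegrableOn g (Ioi (0:ℝ)) ↔ Integrable (fun y => Real.exp y • g (Real.exp y)) := by
  have h := integrableOn_image_iff_integrableOn_abs_deriv_smul (MeasurableSet.univ)
    (fun x _ => (Real.hasDerivAt_exp x).hasDerivWithinAt)
    (fun x _ y _ hxy => Real.exp_injective hxy) g
  simpa [Real.range_exp, abs_of_pos (Real.exp_pos _), integrableOn_univ] using h

/-- Shifting the contour of integration of an entire function inside a horizontal strip on which
it has an integrable majorant vanishing at both ends. -/
theorem integral_horizontal_eq_of_le {H : ℂ → ℂ} (hH : Differentiable ℂ H) {B : ℝ → ℝ}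
    (hB : Integrable B) (hbot : Tendsto B atBot (nhds 0)) (htop : Tendsto B atTop (nhds 0))
    {y₀ y₁ : ℝ} (hbound : ∀ x : ℝ, ∀ y ∈ uIcc y₀ y₁, ‖H (x + y * Complex.I)‖ ≤ B x) :
    ∫ x : ℝ, H (x + y₀ * Complex.I) = ∫ x : ℝ, H (x + y₁ * Complex.I) := by
  have hint : ∀ y ∈ uIcc y₀ y₁, Integrable (fun x : ℝ => H (x + y * Complex.I)) := fun y hy =>
    hB.mono' ((hH.continuous.comp (by fun_prop)).aestronglyMeasurable)
      (Eventually.of_forall fun x => hbound x y hy)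
  have hlim : ∀ y ∈ uIcc y₀ y₁, Tendsto (fun T : ℝ => ∫ x in (-T)..T, H (x + y * Complex.I)) atTop
      (nhds (∫ x : ℝ, H (x + y * Complex.I))) := fun y hy =>
    intervalIntegral_tendsto_integral (hint y hy) tendsto_neg_atTop_atBot tendsto_id
  have hside : ∀ {φ : ℝ → ℝ}, Tendsto (fun T => B (φ T)) atTop (nhds 0) →
      Tendsto (fun T : ℝ => ∫ y in y₀..y₁, H (φ T + y * Complex.I)) atTop (nhds 0) := by
    intro φ hφ
    refine squeeze_zero_norm (fun T => intervalIntegral.norm_integral_le_of_norm_le_const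
      (C := B (φ T)) fun y hy => hbound _ _ (uIoc_subset_uIcc hy)) ?_
    simpa using hφ.mul_const _
  have hrect : ∀ T : ℝ, (∫ x in (-T)..T, H (x + y₀ * Complex.I)) -
      (∫ x in (-T)..T, H (x + y₁ * Complex.I)) =
      Complex.I * (∫ y in y₀..y₁, H ((-T : ℝ) + y * Complex.I)) -
      Complex.I * (∫ y in y₀..y₁, H ((T : ℝ) + y * Complex.I)) := by
    intro T
    have h := Complex.integral_boundary_rect_eq_zero_of_differentiableOn H ⟨-T, y₀⟩ ⟨T, y₁⟩
      hH.differentiableOn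
    simp only [smul_eq_mul] at h
    linear_combination h
  refine sub_eq_zero.1 (tendsto_nhds_unique
    ((hlim y₀ left_mem_uIcc).sub (hlim y₁ right_mem_uIcc)) ?_)
  simp_rw [hrect]
  simpa using ((hside (φ := fun T => -T) (hbot.comp tendsto_neg_atTop_atBot)).const_mul
    Complex.I).sub ((hside (φ := fun T => T) htop).const_mul Complex.I)

/-- Contour rotation for functions of the logarithmic variable, with a stretched exponential
majorant. -/
theorem integral_horizontal_eq_of_stretched {H : ℂ → ℂ} (hH : Differentiable ℂ H) {p q δ : ℝ}
    (hp : 0 < p) (hq : 0 < q) (hδ : 0 < δ) {y₀ y₁ : ℝ}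
    (hbound : ∀ x : ℝ, ∀ y ∈ uIcc y₀ y₁,
      ‖H (x + y * Complex.I)‖ ≤ Real.exp (p * x - δ * Real.exp (q * x))) :
    ∫ x : ℝ, H (x + y₀ * Complex.I) = ∫ x : ℝ, H (x + y₁ * Complex.I) := by
  refine integral_horizontal_eq_of_le hH ?_ ?_ ?_ hbound
  · have h := (integrableOn_Ioi_zero_iff_integrable_exp _).1
      (integrableOn_rpow_mul_exp_neg_mul_rpow (p := q) (s := p - 1) (b := δ) (by linarith) hq hδ)
    refine h.congr (Eventually.of_forall fun x => ?_)
    simp only [smul_eq_mul, ← Real.exp_mul, ← Real.exp_add]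
    congr 1
    rw [mul_comm x q]
    ring
  · refine squeeze_zero (fun _ => (Real.exp_pos _).le) (g := fun x => Real.exp (p * x))
      (fun x => Real.exp_le_exp.2 ?_) ?_
    · nlinarith [Real.exp_pos (q * x)]
    · exact Real.tendsto_exp_atBot.comp (tendsto_id.const_mul_atBot hp)
  · have h1 : Tendsto (fun x : ℝ => Real.exp (q * x)) atTop atTop :=
      Real.tendsto_exp_atTop.comp (tendsto_id.const_mul_atTop hq)
    have h2 := (tendsto_rpow_mul_exp_neg_mul_atTop_nhds_zero (p / q) δ hδ).comp h1
    refine h2.congr fun x => ?_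
    simp only [Function.comp, ← Real.exp_mul, ← Real.exp_add]
    congr 1
    field_simp
    ring

/-- The integrand `z ^ (p - 1) * exp (i z - ε z ^ α)` in the logarithmic variable. -/
noncomputable def logIntegrand (p ε α : ℝ) (ζ : ℂ) : ℂ :=
  Complex.exp (p * ζ + Complex.I * Complex.exp ζ - ε * Complex.exp (α * ζ))

theorem differentiable_logIntegrand (p ε α : ℝ) : Differentiable ℂ (logIntegrand p ε α) := by
  unfold logIntegrand
  fun_prop

theorem norm_logIntegrand (p ε α x y : ℝ) :
    ‖logIntegrand p ε α (x + y * Complex.I)‖ =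
      Real.exp (p * x - Real.exp x * Real.sin y - ε * (Real.exp (α * x) * Real.cos (α * y))) := by
  rw [logIntegrand, Complex.norm_exp]
  congr 1
  simp [Complex.exp_re, Complex.exp_im]
  ring

theorem integral_logIntegrand (p ε α θ : ℝ) :
    ∫ x : ℝ, logIntegrand p ε α (x + θ * Complex.I) =
      ∫ x in Ioi (0:ℝ), ((x ^ (p - 1) : ℝ) : ℂ) * Complex.exp (p * θ * Complex.I +
        Complex.I * Complex.exp (θ * Complex.I) * x -
        ε * Complex.exp (α * θ * Complex.I) * ((x ^ α : ℝ) : ℂ)) := by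
  rw [integral_Ioi_zero_eq_integral_exp]
  congr 1 with x
  rw [logIntegrand, Complex.real_smul, ← mul_assoc, ← Complex.ofReal_mul, ← Real.exp_mul,
    ← Real.exp_mul, ← Real.exp_add, Complex.ofReal_exp, ← Complex.exp_add]
  push_cast
  congr 1
  simp only [mul_add, Complex.exp_add]
  ring_nf

theorem integral_logIntegrand_rotate {α ε : ℝ} (hα : α ∈ Ioo (0:ℝ) 2) (hε : 0 < ε) :
    ∫ x : ℝ, logIntegrand 1 ε α (x + (0:ℝ) * Complex.I) =
      ∫ x : ℝ, logIntegrand 1 ε α (x + (Real.pi / 4 : ℝ) * Complex.I) := by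
  have hpi := Real.pi_pos
  have hcos : 0 < Real.cos (α * (Real.pi / 4)) :=
    Real.cos_pos_of_mem_Ioo ⟨by nlinarith [hα.1], by nlinarith [hα.2]⟩
  refine integral_horizontal_eq_of_stretched (differentiable_logIntegrand _ _ _) one_pos hα.1
    (mul_pos hε hcos) fun x y hy => ?_
  rw [uIcc_of_le (by positivity)] at hy
  rw [norm_logIntegrand]
  have hs : 0 ≤ Real.sin y := Real.sin_nonneg_of_nonneg_of_le_pi hy.1 (by linarith [hy.2])
  have hc : Real.cos (α * (Real.pi / 4)) ≤ Real.cos (α * y) :=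
    Real.cos_le_cos_of_nonneg_of_le_pi (mul_nonneg hα.1.le hy.1) (by nlinarith [hα.2])
      (mul_le_mul_of_nonneg_left hy.2 hα.1.le)
  have h1 := mul_nonneg (Real.exp_pos x).le hs
  have h2 := mul_le_mul_of_nonneg_left hc (mul_pos hε (Real.exp_pos (α * x))).le
  refine Real.exp_le_exp.2 ?_
  linarith

theorem integral_logIntegrand_zero_rotate {α p : ℝ} (hp : 0 < p) :
    ∫ x : ℝ, logIntegrand p 0 α (x + (Real.pi / 4 : ℝ) * Complex.I) =
      ∫ x : ℝ, logIntegrand p 0 α (x + (Real.pi / 2 : ℝ) * Complex.I) := by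
  have hpi := Real.pi_pos
  refine integral_horizontal_eq_of_stretched (differentiable_logIntegrand _ _ _) hp one_pos
    (δ := Real.sin (Real.pi / 4)) (Real.sin_pos_of_pos_of_lt_pi (by positivity) (by linarith))
    fun x y hy => ?_
  rw [uIcc_of_le (by linarith)] at hy
  rw [norm_logIntegrand]
  have hs : Real.sin (Real.pi / 4) ≤ Real.sin y :=
    Real.sin_le_sin_of_le_of_le_pi_div_two (by linarith) hy.2 hy.1
  have h1 := mul_le_mul_of_nonneg_left hs (Real.exp_pos x).le
  refine Real.exp_le_exp.2 ?_
  rw [one_mul]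
  linarith

theorem integral_rpow_mul_exp_I_mul_ray {p : ℝ} (hp : 0 < p) :
    ∫ x in Ioi (0:ℝ), ((x ^ (p - 1) : ℝ) : ℂ) * Complex.exp (p * (Real.pi / 4 : ℝ) * Complex.I +
        Complex.I * Complex.exp ((Real.pi / 4 : ℝ) * Complex.I) * x) =
      Complex.exp (p * (Real.pi / 2 : ℝ) * Complex.I) * (Real.Gamma p : ℝ) := by
  have h := integral_logIntegrand_zero_rotate (α := 1) hp
  rw [integral_logIntegrand, integral_logIntegrand] at h
  simp only [Complex.ofReal_zero, zero_mul, sub_zero] at h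
  rw [h, Real.Gamma_eq_integral hp, ← integral_complex_ofReal, ← integral_const_mul]
  congr 1 with x
  have : Complex.I * Complex.exp ((Real.pi / 2 : ℝ) * Complex.I) = -1 := by
    push_cast
    rw [Complex.exp_pi_div_two_mul_I, Complex.I_mul_I]
  rw [this, Complex.exp_add]
  push_cast
  ring_nf

theorem norm_exp_neg_sub_one_le {z : ℂ} (hz : 0 ≤ z.re) : ‖Complex.exp (-z) - 1‖ ≤ ‖z‖ := by
  have h := (convex_halfSpace_re_ge 0).norm_image_sub_le_of_norm_hasDerivWithin_le
    (f := fun w : ℂ => Complex.exp (-w)) (f' := fun w => Complex.exp (-w) * -1) (C := 1)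
    (x := 0) (y := z)
    (fun w _ => ((hasDerivAt_neg w).cexp).hasDerivWithinAt)
    (fun w hw => by
      have hw' : 0 ≤ w.re := hw
      simpa [Complex.norm_exp] using hw') (by simp) (by simpa using hz)
  simpa using h

/-- First-order behaviour, as the damping disappears, of the damped cosine integral. -/
theorem tendsto_integral_cos_mul_exp_div {α : ℝ} (hα : α ∈ Ioo (0:ℝ) 2) :
    Tendsto (fun ε : ℝ => (∫ x in Ioi (0:ℝ), Real.cos x * Real.exp (-(ε * x ^ α))) / ε)
      (nhdsWithin 0 (Ioi 0)) (nhds (Real.Gamma (α + 1) * Real.sin (Real.pi * α / 2))) := by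
  have hpi := Real.pi_pos
  set ω : ℂ := Complex.exp ((Real.pi / 4 : ℝ) * Complex.I) with hω
  set η : ℂ := Complex.exp (α * (Real.pi / 4 : ℝ) * Complex.I) with hη
  set σ : ℝ := Real.sin (Real.pi / 4) with hσ
  have hσ0 : 0 < σ := Real.sin_pos_of_pos_of_lt_pi (by positivity) (by linarith)
  have hIω : (Complex.I * ω).re = -σ := by simp [hω, Complex.exp_im, hσ]
  have hωn : ‖ω‖ = 1 := Complex.norm_exp_ofReal_mul_I _
  have hηn : ‖η‖ = 1 := by
    rw [hη, ← Complex.ofReal_mul]; exact Complex.norm_exp_ofReal_mul_I _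
  have hηre : 0 ≤ η.re := by
    rw [hη, ← Complex.ofReal_mul, Complex.exp_ofReal_mul_I_re]
    exact (Real.cos_pos_of_mem_Ioo ⟨by nlinarith [hα.1], by nlinarith [hα.2]⟩).le
  have hexpn : ∀ x : ℝ, ‖Complex.exp (Complex.I * ω * x)‖ = Real.exp (-σ * x) := by
    intro x
    rw [Complex.norm_exp, Complex.re_mul_ofReal, hIω]
  have hmeas : ∀ ε : ℝ, AEStronglyMeasurable (fun x : ℝ => ω * Complex.exp (Complex.I * ω * x) *
      (Complex.exp (-(ε * η * ((x ^ α : ℝ) : ℂ))) - 1)) (volume.restrict (Ioi 0)) := by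
    intro ε
    have := (Real.continuous_rpow_const hα.1.le)
    apply Continuous.aestronglyMeasurable
    fun_prop
  have hbd : ∀ ε : ℝ, 0 < ε → ∀ x ∈ Ioi (0:ℝ), ‖ω * Complex.exp (Complex.I * ω * x) *
      (Complex.exp (-(ε * η * ((x ^ α : ℝ) : ℂ))) - 1)‖ ≤
        ε * (x ^ α * Real.exp (-σ * x ^ (1:ℝ))) := by
    intro ε hε x hx
    have hxα : 0 < x ^ α := Real.rpow_pos_of_pos hx _
    rw [norm_mul, norm_mul, hexpn, hωn, Real.rpow_one]
    have h1 : ‖Complex.exp (-(ε * η * ((x ^ α : ℝ) : ℂ))) - 1‖ ≤ ε * x ^ α := by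
      refine (norm_exp_neg_sub_one_le ?_).trans_eq ?_
      · rw [Complex.re_mul_ofReal, Complex.re_ofReal_mul]; positivity
      · rw [norm_mul, norm_mul, hηn, Complex.norm_real, Complex.norm_real, Real.norm_of_nonneg hε.le,
          Real.norm_of_nonneg hxα.le, mul_one]
    nlinarith [Real.exp_pos (-σ * x)]
  have hdom : IntegrableOn (fun x : ℝ => x ^ α * Real.exp (-σ * x ^ (1:ℝ))) (Ioi 0) :=
    integrableOn_rpow_mul_exp_neg_mul_rpow (by linarith [hα.1]) one_pos hσ0
  have hint : ∀ ε : ℝ, 0 < ε → IntegrableOn (fun x : ℝ => ω * Complex.exp (Complex.I * ω * x) *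
      (Complex.exp (-(ε * η * ((x ^ α : ℝ) : ℂ))) - 1)) (Ioi 0) := fun ε hε =>
    (hdom.const_mul ε).mono' (hmeas ε)
      ((ae_restrict_iff' measurableSet_Ioi).2 (Eventually.of_forall (hbd ε hε)))
  have hωint : IntegrableOn (fun x : ℝ => ω * Complex.exp (Complex.I * ω * x)) (Ioi 0) :=
    (integrableOn_exp_mul_complex_Ioi (by rw [hIω]; linarith) 0).const_mul ω
  have hωval : ∫ x in Ioi (0:ℝ), ω * Complex.exp (Complex.I * ω * x) = Complex.I := by
    rw [integral_const_mul, integral_exp_mul_complex_Ioi (by rw [hIω]; linarith)]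
    have : ω ≠ 0 := Complex.exp_ne_zero _
    simp
    field_simp
    simp
  have hrot : ∀ ε : ℝ, 0 < ε → (∫ x in Ioi (0:ℝ), Real.cos x * Real.exp (-(ε * x ^ α))) =
      (∫ x in Ioi (0:ℝ), ω * Complex.exp (Complex.I * ω * x) *
        (Complex.exp (-(ε * η * ((x ^ α : ℝ) : ℂ))) - 1)).re := by
    intro ε hε
    have h := integral_logIntegrand_rotate hα hε
    rw [integral_logIntegrand, integral_logIntegrand] at h
    have hR : ∫ x in Ioi (0:ℝ), ((x ^ ((1:ℝ) - 1) : ℝ) : ℂ) *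
        Complex.exp ((1:ℝ) * (Real.pi / 4 : ℝ) * Complex.I + Complex.I * ω * x -
          ε * η * ((x ^ α : ℝ) : ℂ)) =
        (∫ x in Ioi (0:ℝ), ω * Complex.exp (Complex.I * ω * x) *
        (Complex.exp (-(ε * η * ((x ^ α : ℝ) : ℂ))) - 1)) + Complex.I := by
      have hadd := integral_add (hint ε hε) hωint
      rw [hωval] at hadd
      rw [← hadd]
      congr 1 with x
      rw [sub_self, Real.rpow_zero, sub_eq_add_neg, Complex.exp_add, Complex.exp_add,
        Complex.ofReal_one, one_mul, one_mul]
      ring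
    rw [hR] at h
    have hL : IntegrableOn (fun x : ℝ => ((x ^ ((1:ℝ) - 1) : ℝ) : ℂ) *
        Complex.exp ((1:ℝ) * (0:ℝ) * Complex.I +
          Complex.I * Complex.exp ((0:ℝ) * Complex.I) * x -
          ε * Complex.exp (α * (0:ℝ) * Complex.I) * ((x ^ α : ℝ) : ℂ))) (Ioi 0) := by
      have h0 := integrableOn_rpow_mul_exp_neg_mul_rpow (s := 0) (by norm_num) hα.1 hε
      refine h0.mono' ?_ (Eventually.of_forall fun x => ?_)
      · have := (Real.continuous_rpow_const hα.1.le)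
        simp only [sub_self, Real.rpow_zero]
        apply Continuous.aestronglyMeasurable
        fun_prop
      · simp [Complex.norm_exp]
    have hre := congrArg Complex.re h
    rw [Complex.add_re, Complex.I_re, add_zero] at hre
    rw [← hre, ← RCLike.re_to_complex, ← integral_re hL]
    congr 1 with x
    simp [Complex.exp_re]
    ring
  have hlimval : (∫ x in Ioi (0:ℝ), ω * Complex.exp (Complex.I * ω * x) *
      (-(η * ((x ^ α : ℝ) : ℂ)))).re = Real.Gamma (α + 1) * Real.sin (Real.pi * α / 2) := by
    have h := integral_rpow_mul_exp_I_mul_ray (p := α + 1) (by linarith [hα.1])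
    have h2 : ∫ x in Ioi (0:ℝ), ω * Complex.exp (Complex.I * ω * x) *
        (-(η * ((x ^ α : ℝ) : ℂ))) =
        -(Complex.exp ((α + 1 : ℝ) * (Real.pi / 2 : ℝ) * Complex.I) *
          (Real.Gamma (α + 1) : ℝ)) := by
      rw [← h, ← integral_neg]
      congr 1 with x
      rw [add_sub_cancel_right, Complex.exp_add, Complex.ofReal_add, add_mul, add_mul,
        Complex.exp_add, Complex.ofReal_one, one_mul]
      ring
    rw [h2, Complex.neg_re, Complex.re_mul_ofReal, ← Complex.ofReal_mul,
      Complex.exp_ofReal_mul_I_re, show (α + 1) * (Real.pi / 2) = Real.pi * α / 2 + Real.pi / 2 by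
        ring, Real.cos_add_pi_div_two]
    ring
  rw [← hlimval]
  have hDC : Tendsto (fun ε : ℝ => ∫ x in Ioi (0:ℝ), (ε : ℂ)⁻¹ *
      (ω * Complex.exp (Complex.I * ω * x) *
        (Complex.exp (-(ε * η * ((x ^ α : ℝ) : ℂ))) - 1))) (nhdsWithin 0 (Ioi 0))
      (nhds (∫ x in Ioi (0:ℝ), ω * Complex.exp (Complex.I * ω * x) *
        (-(η * ((x ^ α : ℝ) : ℂ))))) := by
    refine tendsto_integral_filter_of_dominated_convergence _
      (Eventually.of_forall fun ε => (hmeas ε).const_mul _) ?_ hdom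
      (Eventually.of_forall fun x => ?_)
    · filter_upwards [self_mem_nhdsWithin] with ε (hε : 0 < ε)
      refine (ae_restrict_iff' measurableSet_Ioi).2 (Eventually.of_forall fun x hx => ?_)
      rw [norm_mul, norm_inv, Complex.norm_real, Real.norm_of_nonneg hε.le, inv_mul_le_iff₀ hε]
      exact hbd ε hε x hx
    · have hd : HasDerivAt (fun ε : ℝ => Complex.exp (-(ε * η * ((x ^ α : ℝ) : ℂ))))
          (-(η * ((x ^ α : ℝ) : ℂ))) 0 := by
        have h := ((((hasDerivAt_id (0:ℝ)).ofReal_comp.mul_const η).mul_const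
          ((x ^ α : ℝ) : ℂ)).neg).cexp
        simpa using h
      have hs := (hasDerivAt_iff_tendsto_slope.1 hd).mono_left
        (nhdsWithin_mono 0 fun y (hy : 0 < y) => hy.ne')
      refine (hs.const_mul (ω * Complex.exp (Complex.I * ω * x))).congr fun ε => ?_
      simp [slope_def_module]
      ring
  refine ((Complex.continuous_re.tendsto _).comp hDC).congr' ?_
  filter_upwards [self_mem_nhdsWithin] with ε (hε : 0 < ε)
  simp only [Function.comp]
  rw [integral_const_mul, hrot ε hε, ← Complex.ofReal_inv, Complex.re_ofReal_mul]
  ring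

/-- The cosine transform of `exp (-b v ^ α)`, up to a constant a symmetric stable density. -/
noncomputable def stableCos (α b t : ℝ) : ℝ :=
  ∫ v in Ioi (0:ℝ), Real.cos (t * v) * Real.exp (-(b * v ^ α))

theorem tendsto_rpow_mul_stableCos {α b : ℝ} (hα : α ∈ Ioo (0:ℝ) 2) (hb : 0 < b) :
    Tendsto (fun t : ℝ => t ^ (α + 1) * stableCos α b t) atTop
      (nhds (b * (Real.Gamma (α + 1) * Real.sin (Real.pi * α / 2)))) := by
  have hε : Tendsto (fun t : ℝ => b * t ^ (-α)) atTop (nhdsWithin 0 (Ioi 0)) := by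
    refine tendsto_nhdsWithin_iff.2 ⟨?_, ?_⟩
    · simpa using (tendsto_rpow_neg_atTop hα.1).const_mul b
    · filter_upwards [eventually_gt_atTop 0] with t ht
      exact mul_pos hb (Real.rpow_pos_of_pos ht _)
  refine (((tendsto_integral_cos_mul_exp_div hα).comp hε).const_mul b).congr' ?_
  filter_upwards [eventually_gt_atTop 0] with t ht
  have hsub := integral_comp_mul_left_Ioi
    (fun x : ℝ => Real.cos x * Real.exp (-(b * t ^ (-α) * x ^ α))) 0 ht
  have hcongr : stableCos α b t = ∫ v in Ioi (0:ℝ),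
      Real.cos (t * v) * Real.exp (-(b * t ^ (-α) * (t * v) ^ α)) := by
    refine setIntegral_congr_fun measurableSet_Ioi fun v (hv : 0 < v) => ?_
    have : t ^ (-α) * t ^ α = 1 := by rw [← Real.rpow_add ht]; simp
    simp only [Real.mul_rpow ht.le hv.le]
    rw [show b * t ^ (-α) * (t ^ α * v ^ α) = b * v ^ α * (t ^ (-α) * t ^ α) by ring, this, mul_one]
  rw [hcongr, hsub, mul_zero, smul_eq_mul]
  simp only [Function.comp]
  have h1 : t ^ α ≠ 0 := (Real.rpow_pos_of_pos ht _).ne'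
  rw [Real.rpow_add ht, Real.rpow_one, Real.rpow_neg ht.le]
  field_simp

theorem integrableOn_exp_neg_mul_rpow {α b : ℝ} (hα : 0 < α) (hb : 0 < b) :
    IntegrableOn (fun v : ℝ => Real.exp (-(b * v ^ α))) (Ioi 0) := by
  simpa using integrableOn_rpow_mul_exp_neg_mul_rpow (s := 0) (by norm_num) hα hb

/-- The regularised double primitive of `stableCos`. -/
noncomputable def stableCosPrimitive (α b t : ℝ) : ℝ :=
  ∫ v in Ioi (0:ℝ), Real.sin (t * v / 2) ^ 2 * Real.exp (-(b * v ^ α)) / v ^ 2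

/-- The derivative of `stableCosPrimitive`. -/
noncomputable def stableSin (α b t : ℝ) : ℝ :=
  ∫ v in Ioi (0:ℝ), Real.sin (t * v) / (2 * v) * Real.exp (-(b * v ^ α))

theorem abs_sin_div_mul_exp_le {v : ℝ} (hv : 0 < v) (t e : ℝ) :
    ‖Real.sin (t * v) / (2 * v) * Real.exp e‖ ≤ |t| * Real.exp e := by
  rw [norm_mul, Real.norm_of_nonneg (Real.exp_pos e).le, norm_div, Real.norm_eq_abs,
    Real.norm_of_nonneg (by positivity : 0 ≤ 2 * v)]
  refine mul_le_mul_of_nonneg_right ?_ (Real.exp_pos e).le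
  rw [div_le_iff₀ (by positivity)]
  have := Real.abs_sin_le_abs (x := t * v)
  rw [abs_mul, abs_of_pos hv] at this
  nlinarith [mul_nonneg (abs_nonneg t) hv.le]

theorem aestronglyMeasurable_sin_div_mul_exp (α b t : ℝ) :
    AEStronglyMeasurable (fun v : ℝ => Real.sin (t * v) / (2 * v) * Real.exp (-(b * v ^ α)))
      (volume.restrict (Ioi 0)) :=
  Measurable.aestronglyMeasurable (by fun_prop)

theorem hasDerivAt_stableCosPrimitive {α b : ℝ} (hα : 0 < α) (hb : 0 < b) (t : ℝ) :
    HasDerivAt (stableCosPrimitive α b) (stableSin α b t) t := by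
  have hφ := integrableOn_exp_neg_mul_rpow hα hb
  refine (hasDerivAt_integral_of_dominated_loc_of_deriv_le (μ := volume.restrict (Ioi 0))
    (F := fun t v => Real.sin (t * v / 2) ^ 2 * Real.exp (-(b * v ^ α)) / v ^ 2)
    (F' := fun t v => Real.sin (t * v) / (2 * v) * Real.exp (-(b * v ^ α)))
    (bound := fun v => (|t| + 1) * Real.exp (-(b * v ^ α))) (Metric.ball_mem_nhds t one_pos)
    (Eventually.of_forall fun x => Measurable.aestronglyMeasurable (by fun_prop)) ?_
    (aestronglyMeasurable_sin_div_mul_exp α b t) ?_ (hφ.const_mul _) ?_).2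
  · refine (hφ.const_mul ((t / 2) ^ 2)).mono' (Measurable.aestronglyMeasurable (by fun_prop)) ?_
    refine (ae_restrict_iff' measurableSet_Ioi).2 (Eventually.of_forall fun v (hv : 0 < v) => ?_)
    rw [Real.norm_of_nonneg (by positivity), div_le_iff₀ (by positivity)]
    have := Real.sin_sq_le_sq (x := t * v / 2)
    have h2 := mul_le_mul_of_nonneg_right this (Real.exp_pos (-(b * v ^ α))).le
    linarith
  · refine (ae_restrict_iff' measurableSet_Ioi).2
      (Eventually.of_forall fun v (hv : 0 < v) x hx => ?_)
    refine (abs_sin_div_mul_exp_le hv x _).trans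
      (mul_le_mul_of_nonneg_right ?_ (Real.exp_pos _).le)
    have h1 : |x - t| < 1 := hx
    have h2 := abs_add_le (x - t) t
    rw [sub_add_cancel] at h2
    linarith
  · refine (ae_restrict_iff' measurableSet_Ioi).2
      (Eventually.of_forall fun v (hv : 0 < v) x _ => ?_)
    have h := (((((hasDerivAt_id x).mul_const v).div_const 2).sin.pow 2).mul_const
      (Real.exp (-(b * v ^ α)))).div_const (v ^ 2)
    refine h.congr_deriv ?_
    have hx : Real.sin (x * v) = 2 * Real.sin (x * v / 2) * Real.cos (x * v / 2) := by
      rw [← Real.sin_two_mul]; ring_nf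
    simp only [id, hx]
    field_simp
    simp
    ring

theorem hasDerivAt_stableSin {α b : ℝ} (hα : 0 < α) (hb : 0 < b) (t : ℝ) :
    HasDerivAt (stableSin α b) (stableCos α b t / 2) t := by
  have hφ := integrableOn_exp_neg_mul_rpow hα hb
  rw [stableCos, ← integral_div]
  refine (hasDerivAt_integral_of_dominated_loc_of_deriv_le (μ := volume.restrict (Ioi 0))
    (F := fun t v => Real.sin (t * v) / (2 * v) * Real.exp (-(b * v ^ α)))
    (F' := fun t v => Real.cos (t * v) * Real.exp (-(b * v ^ α)) / 2)
    (bound := fun v => Real.exp (-(b * v ^ α))) (Metric.ball_mem_nhds t one_pos)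
    (Eventually.of_forall fun x => aestronglyMeasurable_sin_div_mul_exp α b x) ?_
    (Measurable.aestronglyMeasurable (by fun_prop)) ?_ hφ ?_).2
  · refine (hφ.const_mul |t|).mono' (aestronglyMeasurable_sin_div_mul_exp α b t) ?_
    exact (ae_restrict_iff' measurableSet_Ioi).2
      (Eventually.of_forall fun v hv => abs_sin_div_mul_exp_le hv t _)
  · refine Eventually.of_forall fun v x _ => ?_
    have h1 := Real.abs_cos_le_one (x * v)
    have h2 := Real.exp_pos (-(b * v ^ α))
    rw [norm_div, norm_mul, Real.norm_of_nonneg h2.le, Real.norm_eq_abs, Real.norm_ofNat]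
    nlinarith
  · refine (ae_restrict_iff' measurableSet_Ioi).2
      (Eventually.of_forall fun v (hv : 0 < v) x _ => ?_)
    have h := ((((hasDerivAt_id x).mul_const v).sin).div_const (2 * v)).mul_const
      (Real.exp (-(b * v ^ α)))
    refine h.congr_deriv ?_
    simp only [id]
    field_simp

theorem integrableOn_sin_half_sq_div_sq :
    IntegrableOn (fun u : ℝ => Real.sin (u / 2) ^ 2 / u ^ 2) (Ioi 0) := by
  refine ((integrable_inv_one_add_sq.const_mul 2).integrableOn).mono'
    (Measurable.aestronglyMeasurable (by fun_prop)) ?_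
  refine (ae_restrict_iff' measurableSet_Ioi).2 (Eventually.of_forall fun u (hu : 0 < u) => ?_)
  rw [Real.norm_of_nonneg (by positivity), ← div_eq_mul_inv, div_le_div_iff₀ (by positivity)
    (by positivity)]
  nlinarith [Real.sin_sq_le_sq (x := u / 2), Real.sin_sq_le_one (u / 2), sq_nonneg u]

theorem fVar_eq {α c a s : ℝ} (hc : 0 < c) (hs : 0 < s) :
    fVar α c a s = 4 / (a * Real.pi) *
      (s * (∫ u in Ioi (0:ℝ), Real.sin (u / 2) ^ 2 / u ^ 2) -
        stableCosPrimitive α (2 * c) s) := by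
  have hint : IntegrableOn
      (fun u : ℝ => Real.sin (u / 2) ^ 2 * Real.exp (-(2 * c * (u / s) ^ α)) / u ^ 2) (Ioi 0) := by
    refine integrableOn_sin_half_sq_div_sq.mono' (Measurable.aestronglyMeasurable (by fun_prop)) ?_
    refine (ae_restrict_iff' measurableSet_Ioi).2 (Eventually.of_forall fun u (hu : 0 < u) => ?_)
    rw [Real.norm_of_nonneg (by positivity)]
    gcongr
    refine mul_le_of_le_one_right (sq_nonneg _) (Real.exp_le_one_iff.2 ?_)
    have : 0 ≤ (u / s) ^ α := by positivity
    nlinarith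
  have hsplit : (∫ u in Ioi (0:ℝ),
      Real.sin (u / 2) ^ 2 * (1 - Real.exp (-(2 * c * (u / s) ^ α))) / u ^ 2) =
      (∫ u in Ioi (0:ℝ), Real.sin (u / 2) ^ 2 / u ^ 2) -
      ∫ u in Ioi (0:ℝ), Real.sin (u / 2) ^ 2 * Real.exp (-(2 * c * (u / s) ^ α)) / u ^ 2 := by
    rw [← integral_sub integrableOn_sin_half_sq_div_sq hint]
    congr 1 with u
    ring
  have hsub := integral_comp_mul_left_Ioi' (fun u : ℝ =>
    Real.sin (u / 2) ^ 2 * Real.exp (-(2 * c * (u / s) ^ α)) / u ^ 2) 0 hs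
  have hprim : stableCosPrimitive α (2 * c) s =
      s * ∫ u in Ioi (0:ℝ), Real.sin (u / 2) ^ 2 * Real.exp (-(2 * c * (u / s) ^ α)) / u ^ 2 := by
    rw [mul_zero, smul_eq_mul] at hsub
    rw [stableCosPrimitive, ← hsub, ← integral_const_mul, ← integral_const_mul]
    congr 1 with v
    rw [mul_div_cancel_left₀ v hs.ne']
    field_simp
  rw [fVar, hsplit, hprim]
  ring

/-- A second difference is a value of the second derivative. -/
theorem exists_second_difference_eq {F F' F'' : ℝ → ℝ} (hF : ∀ x, HasDerivAt F (F' x) x)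
    (hF' : ∀ x, HasDerivAt F' (F'' x) x) {s r : ℝ} (hs : 0 < s) (hr : 0 < r) (u : ℝ) :
    ∃ ξ ∈ Ioo u (s + r + u),
      F (s + r + u) - F (r + u) - F (s + u) + F u = s * r * F'' ξ := by
  have hq : ∀ x, HasDerivAt (fun x => F (s + x) - F x) (F' (s + x) - F' x) x := fun x =>
    ((hF (s + x)).comp_const_add s x).sub (hF x)
  obtain ⟨ξ₁, hξ₁, h₁⟩ := exists_hasDerivAt_eq_slope _ _ (by linarith : u < r + u)
    (fun x _ => (hq x).continuousAt.continuousWithinAt) (fun x _ => hq x)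
  obtain ⟨ξ, hξ, h₂⟩ := exists_hasDerivAt_eq_slope _ _ (by linarith : ξ₁ < s + ξ₁)
    (fun x _ => (hF' x).continuousAt.continuousWithinAt) (fun x _ => hF' x)
  refine ⟨ξ, ⟨hξ₁.1.trans hξ.1, by linarith [hξ.2, hξ₁.2]⟩, ?_⟩
  rw [add_sub_cancel_right, eq_div_iff (by positivity)] at h₁ h₂
  rw [add_assoc]
  linear_combination -h₁ - r * h₂

theorem tendsto_rpow_mul_second_difference {F F' F'' : ℝ → ℝ} (hF : ∀ x, HasDerivAt F (F' x) x)
    (hF' : ∀ x, HasDerivAt F' (F'' x) x) {p K : ℝ}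
    (hK : Tendsto (fun t => t ^ p * F'' t) atTop (nhds K))
    {s r : ℝ} (hs : 0 < s) (hr : 0 < r) :
    Tendsto (fun u => u ^ p * (F (s + r + u) - F (r + u) - F (s + u) + F u)) atTop
      (nhds (s * r * K)) := by
  choose ξ hξ hξe using exists_second_difference_eq hF hF' hs hr
  have hξtop : Tendsto ξ atTop atTop := tendsto_atTop_mono (fun u => (hξ u).1.le) tendsto_id
  have hratio : Tendsto (fun u => u / ξ u) atTop (nhds 1) := by
    have hlow : Tendsto (fun u : ℝ => 1 - (s + r) / u) atTop (nhds 1) := by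
      simpa using tendsto_const_nhds.sub ((tendsto_const_nhds (x := s + r)).div_atTop tendsto_id)
    refine tendsto_of_tendsto_of_tendsto_of_le_of_le' hlow tendsto_const_nhds ?_ ?_
    · filter_upwards [eventually_gt_atTop 0] with u hu
      have hξu := hξ u
      have hpos : 0 < ξ u := hu.trans hξu.1
      rw [le_div_iff₀ hpos, one_sub_mul, div_mul_eq_mul_div, sub_le_iff_le_add,
        ← sub_le_iff_le_add', le_div_iff₀ hu]
      nlinarith [hξu.1, hξu.2]
    · filter_upwards [eventually_gt_atTop 0] with u hu
      exact (div_le_one (hu.trans (hξ u).1)).2 (hξ u).1.le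
  have hpow : Tendsto (fun u => (u / ξ u) ^ p) atTop (nhds 1) := by
    simpa using hratio.rpow_const (p := p) (Or.inl one_ne_zero)
  have hlim := ((hpow.mul (hK.comp hξtop)).const_mul (s * r))
  rw [one_mul] at hlim
  refine hlim.congr' ?_
  filter_upwards [eventually_gt_atTop 0] with u hu
  have hpos : 0 < ξ u := hu.trans (hξ u).1
  have := (Real.rpow_pos_of_pos hpos p).ne'
  rw [hξe, Real.div_rpow hu.le hpos.le]
  simp only [Function.comp]
  field_simp

theorem long_range_dependence (α c a s r : ℝ) (hα : α ∈ Set.Ioo (0:ℝ) 2)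
    (hc : 0 < c) (ha : 0 < a) (hs : 0 < s) (hr : 0 < r) :
    ∃ k : ℝ, k ≠ 0 ∧
      Tendsto (fun u : ℝ => u ^ (α + 1) *
          (fVar α c a (s + r + u) - fVar α c a (r + u) -
            fVar α c a (s + u) + fVar α c a u))
        atTop (nhds k) := by
  have hpi := Real.pi_pos
  have hsin : 0 < Real.sin (Real.pi * α / 2) :=
    Real.sin_pos_of_pos_of_lt_pi (by nlinarith [hα.1]) (by nlinarith [hα.2])
  have hΓ : 0 < Real.Gamma (α + 1) := Real.Gamma_pos_of_pos (by linarith [hα.1])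
  have hb : 0 < 2 * c := by positivity
  have hK : Tendsto (fun t : ℝ => t ^ (α + 1) * (stableCos α (2 * c) t / 2)) atTop
      (nhds (2 * c * (Real.Gamma (α + 1) * Real.sin (Real.pi * α / 2)) / 2)) := by
    simpa only [mul_div_assoc] using (tendsto_rpow_mul_stableCos hα hb).div_const 2
  have hlim := (tendsto_rpow_mul_second_difference (hasDerivAt_stableCosPrimitive hα.1 hb)
    (hasDerivAt_stableSin hα.1 hb) hK hs hr).const_mul (-(4 / (a * Real.pi)))
  refine ⟨_, ?_, hlim.congr' ?_⟩
  · exact mul_ne_zero (neg_ne_zero.2 (by positivity)) (by positivity)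
  · filter_upwards [eventually_gt_atTop 0] with u hu
    rw [fVar_eq hc (by positivity), fVar_eq hc (by positivity), fVar_eq hc (by positivity),
      fVar_eq hc hu]
    ring
end

section
/- (Fractional Brownian motion scaling limit) For every α ∈ (0,1), c > 0, a > 0 and s > 0, lim_{b→∞} f^{α,c,a}(bs)/b^{1−α} = k_{α,c,a} · s^{1−α}, where k_{α,c,a} = (4c/(aπ)) Γ(α−1) sin(−απ/2) and Γ denotes the Gamma function (extended to the interval (−1,0) by the functional equation); consequently the rescaled covariances b^{α−1}·(1/2)(f(br)+f(bs)−f(b|s−r|)) converge to (k_{α,c,a}/2)(s^{1−α} + r^{1−α} − |s−r|^{1−α}), the covariance of √(k_{α,c,a}) times a fractional Brownian motion of Hurst parameter (1−α)/2. -/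
open MeasureTheory Filter Set

/-- Tonelli's theorem on the quadrant, for a nonnegative function whose partial integrals are known
in closed form. -/
theorem integrableOn_and_integral_eq_of_nonneg_swap {f : ℝ → ℝ → ℝ} {g h : ℝ → ℝ}
    (hf : Measurable (Function.uncurry f))
    (hf0 : ∀ x ∈ Ioi (0 : ℝ), ∀ y ∈ Ioi (0 : ℝ), 0 ≤ f x y)
    (hfi : ∀ y ∈ Ioi (0 : ℝ), IntegrableOn (fun x => f x y) (Ioi 0))
    (hh : ∀ y ∈ Ioi (0 : ℝ), ∫ x in Ioi (0 : ℝ), f x y = h y)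
    (hg : ∀ x ∈ Ioi (0 : ℝ), ∫ y in Ioi (0 : ℝ), f x y = g x)
    (hhi : IntegrableOn h (Ioi 0)) :
    IntegrableOn g (Ioi 0) ∧ ∫ x in Ioi (0 : ℝ), g x = ∫ y in Ioi (0 : ℝ), h y := by
  have hint : Integrable (Function.uncurry f)
      ((volume.restrict (Ioi (0 : ℝ))).prod (volume.restrict (Ioi (0 : ℝ)))) := by
    rw [integrable_prod_iff' hf.aestronglyMeasurable]
    refine ⟨(ae_restrict_mem measurableSet_Ioi).mono hfi, ?_⟩
    refine IntegrableOn.congr_fun hhi (fun y hy => ?_) measurableSet_Ioi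
    rw [← hh y hy]
    refine setIntegral_congr_fun measurableSet_Ioi fun x hx => ?_
    exact (Real.norm_of_nonneg (hf0 x hx y hy)).symm
  refine ⟨IntegrableOn.congr_fun hint.integral_prod_left hg measurableSet_Ioi, ?_⟩
  rw [← setIntegral_congr_fun measurableSet_Ioi hg, ← setIntegral_congr_fun measurableSet_Ioi hh]
  exact integral_integral_swap hint

theorem integral_rpow_div_one_add_sq {α : ℝ} (hα : α ∈ Ioo (0 : ℝ) 1) :
    IntegrableOn (fun t : ℝ => t ^ (-α) / (1 + t ^ 2)) (Ioi 0) ∧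
      ∫ t in Ioi (0 : ℝ), t ^ (-α) / (1 + t ^ 2) =
        Real.pi / (2 * Real.cos (Real.pi * α / 2)) := by
  obtain ⟨h0, h1⟩ := hα
  set C := 1 / 2 * Real.Gamma ((1 - α) / 2) with hC
  have key := integrableOn_and_integral_eq_of_nonneg_swap
    (f := fun t v : ℝ => t ^ (-α) * Real.exp (-((1 + t ^ 2) * v)))
    (g := fun t => t ^ (-α) / (1 + t ^ 2))
    (h := fun v => C * (Real.exp (-v) * v ^ ((1 + α) / 2 - 1)))
    (by
      have : Measurable fun p : ℝ × ℝ => p.1 ^ (-α) * Real.exp (-((1 + p.1 ^ 2) * p.2)) := by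
        fun_prop
      exact this)
    (fun x hx y hy => by
      have : (0 : ℝ) < x := hx
      positivity)
    (fun v hv => by
      have := (integrableOn_rpow_mul_exp_neg_mul_sq (b := v) hv (s := -α)
        (by linarith)).const_mul (Real.exp (-v))
      refine IntegrableOn.congr_fun this (fun t _ => ?_) measurableSet_Ioi
      have : Real.exp (-((1 + t ^ 2) * v)) = Real.exp (-v) * Real.exp (-v * t ^ 2) := by
        rw [← Real.exp_add]; ring_nf
      simp only [this]; ring)
    (fun v hv => by
      have e := integral_rpow_mul_exp_neg_mul_rpow (p := 2) (q := -α) (b := v) two_pos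
        (by linarith) hv
      calc ∫ t in Ioi (0 : ℝ), t ^ (-α) * Real.exp (-((1 + t ^ 2) * v))
          = ∫ t in Ioi (0 : ℝ), Real.exp (-v) * (t ^ (-α) * Real.exp (-v * t ^ (2 : ℝ))) := by
            refine setIntegral_congr_fun measurableSet_Ioi fun t _ => ?_
            have : Real.exp (-((1 + t ^ 2) * v)) = Real.exp (-v) * Real.exp (-v * t ^ 2) := by
              rw [← Real.exp_add]; ring_nf
            simp only [this, Real.rpow_two]; ring
        _ = _ := by
            rw [integral_const_mul, e, hC, show (-(-α + 1) / 2 : ℝ) = (1 + α) / 2 - 1 by ring,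
              show (-α + 1) / 2 = (1 - α) / 2 by ring]
            ring)
    (fun t ht => by
      have e := Real.integral_rpow_mul_exp_neg_mul_Ioi (a := 1) (r := 1 + t ^ 2) one_pos
        (by positivity)
      simp only [sub_self, Real.rpow_zero, one_mul, Real.rpow_one, Real.Gamma_one, mul_one] at e
      rw [integral_const_mul, e, mul_one_div])
    ((Real.GammaIntegral_convergent (s := (1 + α) / 2) (by linarith)).const_mul C)
  refine ⟨key.1, key.2.trans ?_⟩
  rw [integral_const_mul, ← Real.Gamma_eq_integral (by linarith), hC]
  have := Real.Gamma_mul_Gamma_one_sub ((1 + α) / 2)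
  rw [show 1 - (1 + α) / 2 = (1 - α) / 2 by ring,
    show Real.pi * ((1 + α) / 2) = Real.pi * α / 2 + Real.pi / 2 by ring,
    Real.sin_add_pi_div_two] at this
  calc _ = 1 / 2 * (Real.Gamma ((1 + α) / 2) * Real.Gamma ((1 - α) / 2)) := by ring
    _ = _ := by rw [this, div_mul_div_comm, one_mul]

/-- The Laplace transform of `1 - cos`. -/
theorem integral_one_sub_cos_mul_exp_neg_mul {t : ℝ} (ht : 0 < t) :
    IntegrableOn (fun u : ℝ => (1 - Real.cos u) * Real.exp (-(u * t))) (Ioi 0) ∧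
      ∫ u in Ioi (0 : ℝ), (1 - Real.cos u) * Real.exp (-(u * t)) = 1 / (t * (1 + t ^ 2)) := by
  set G : ℝ → ℝ := fun u =>
    Real.exp (-(u * t)) * (-1 / t - (Real.sin u - t * Real.cos u) / (1 + t ^ 2)) with hG
  have hderiv : ∀ u ∈ Ici (0 : ℝ),
      HasDerivAt G ((1 - Real.cos u) * Real.exp (-(u * t))) u := fun u _ => by
    have h1 : HasDerivAt (fun u : ℝ => Real.exp (-(u * t))) (Real.exp (-(u * t)) * -(1 * t)) u :=
      (((hasDerivAt_id u).mul_const t).neg).exp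
    have h2 : HasDerivAt
        (fun u : ℝ => -1 / t - (Real.sin u - t * Real.cos u) / (1 + t ^ 2))
        (-((Real.cos u - t * -Real.sin u) / (1 + t ^ 2))) u :=
      (((Real.hasDerivAt_sin u).sub ((Real.hasDerivAt_cos u).const_mul t)).div_const _).const_sub _
    convert! h1.mul h2 using 1
    field_simp
    ring
  have hpos : ∀ u ∈ Ioi (0 : ℝ), 0 ≤ (1 - Real.cos u) * Real.exp (-(u * t)) := fun u _ =>
    mul_nonneg (sub_nonneg.2 (Real.cos_le_one u)) (Real.exp_pos _).le
  have hlim : Tendsto G atTop (nhds 0) := by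
    refine Tendsto.zero_mul_isBoundedUnder_le ?_ ?_
    · exact Real.tendsto_exp_neg_atTop_nhds_zero.comp (tendsto_id.atTop_mul_const ht)
    · refine isBoundedUnder_of ⟨1 / t + (1 + t) / (1 + t ^ 2), fun u => ?_⟩
      have hs := abs_le.1 (Real.abs_sin_le_one u)
      have hc := abs_le.1 (Real.abs_cos_le_one u)
      have hb : |(Real.sin u - t * Real.cos u)| ≤ 1 + t := by
        rw [abs_le]; constructor <;> nlinarith
      calc ‖-1 / t - (Real.sin u - t * Real.cos u) / (1 + t ^ 2)‖
          ≤ ‖-1 / t‖ + ‖(Real.sin u - t * Real.cos u) / (1 + t ^ 2)‖ := norm_sub_le _ _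
        _ ≤ _ := by
          rw [Real.norm_eq_abs, Real.norm_eq_abs, abs_div, abs_div, abs_neg, abs_one,
            abs_of_pos ht, abs_of_pos (show 0 < 1 + t ^ 2 by positivity)]
          gcongr
  refine ⟨integrableOn_Ioi_deriv_of_nonneg' hderiv hpos hlim, ?_⟩
  rw [integral_Ioi_of_hasDerivAt_of_nonneg' hderiv hpos hlim]
  simp only [hG, zero_mul, neg_zero, Real.exp_zero, Real.sin_zero, Real.cos_zero]
  field_simp
  ring

theorem integral_one_sub_cos_mul_rpow_s15 {α : ℝ} (hα : α ∈ Ioo (0 : ℝ) 1) :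
    IntegrableOn (fun u : ℝ => (1 - Real.cos u) * u ^ (α - 2)) (Ioi 0) ∧
      ∫ u in Ioi (0 : ℝ), (1 - Real.cos u) * u ^ (α - 2) =
        Real.Gamma (α - 1) * Real.sin (-α * Real.pi / 2) := by
  have h0 := hα.1
  have h1 := hα.2
  have hΓ : 0 < Real.Gamma (2 - α) := Real.Gamma_pos_of_pos (by linarith)
  obtain ⟨hi, hv⟩ := integral_rpow_div_one_add_sq hα
  have key := integrableOn_and_integral_eq_of_nonneg_swap
    (f := fun u t : ℝ => (1 - Real.cos u) * (t ^ (1 - α) * Real.exp (-(u * t))))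
    (g := fun u => Real.Gamma (2 - α) * ((1 - Real.cos u) * u ^ (α - 2)))
    (h := fun t => t ^ (-α) / (1 + t ^ 2))
    (by
      have : Measurable fun p : ℝ × ℝ =>
          (1 - Real.cos p.1) * (p.2 ^ (1 - α) * Real.exp (-(p.1 * p.2))) := by
        fun_prop
      exact this)
    (fun x _ y hy => by
      have hy' : (0 : ℝ) < y := hy
      have := sub_nonneg.2 (Real.cos_le_one x)
      positivity)
    (fun t ht => by
      refine IntegrableOn.congr_fun
        ((integral_one_sub_cos_mul_exp_neg_mul ht).1.const_mul (t ^ (1 - α)))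
        (fun u _ => ?_) measurableSet_Ioi
      ring)
    (fun t ht => by
      have ht' : (0 : ℝ) < t := ht
      calc _ = ∫ u in Ioi (0 : ℝ), t ^ (1 - α) * ((1 - Real.cos u) * Real.exp (-(u * t))) := by
            refine setIntegral_congr_fun measurableSet_Ioi fun u _ => ?_
            ring
        _ = _ := by
            rw [integral_const_mul, (integral_one_sub_cos_mul_exp_neg_mul ht).2,
              show 1 - α = -α + 1 by ring, Real.rpow_add_one ht'.ne']
            field_simp)
    (fun u hu => by
      have hu' : (0 : ℝ) < u := hu
      have e := Real.integral_rpow_mul_exp_neg_mul_Ioi (a := 2 - α) (r := u) (by linarith) hu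
      rw [show 2 - α - 1 = 1 - α by ring, one_div, Real.inv_rpow hu'.le, ← Real.rpow_neg hu'.le,
        neg_sub] at e
      rw [integral_const_mul, e]
      ring)
    hi
  obtain ⟨ki, kv⟩ := key
  constructor
  · refine IntegrableOn.congr_fun (ki.const_mul (Real.Gamma (2 - α))⁻¹) (fun u _ => ?_)
      measurableSet_Ioi
    exact inv_mul_cancel_left₀ hΓ.ne' _
  · rw [integral_const_mul, hv] at kv
    have hrefl := Real.Gamma_mul_Gamma_one_sub (α - 1)
    rw [show 1 - (α - 1) = 2 - α by ring,
      show Real.pi * (α - 1) = 2 * (Real.pi * α / 2) - Real.pi by ring, Real.sin_sub_pi,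
      Real.sin_two_mul] at hrefl
    have hx1 : Real.pi * α / 2 < Real.pi / 2 := by nlinarith [Real.pi_pos]
    have hx0 : 0 < Real.pi * α / 2 := by have := Real.pi_pos; positivity
    have hcos : 0 < Real.cos (Real.pi * α / 2) :=
      Real.cos_pos_of_mem_Ioo ⟨by linarith, hx1⟩
    have hsin : 0 < Real.sin (Real.pi * α / 2) :=
      Real.sin_pos_of_pos_of_lt_pi hx0 (by linarith)
    rw [show -α * Real.pi / 2 = -(Real.pi * α / 2) by ring, Real.sin_neg]
    refine mul_left_cancel₀ hΓ.ne' ?_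
    rw [kv]
    calc _ = Real.pi / -(2 * Real.sin (Real.pi * α / 2) * Real.cos (Real.pi * α / 2)) *
          -Real.sin (Real.pi * α / 2) := by field_simp
      _ = _ := by rw [← hrefl]; ring

theorem tendsto_mul_one_sub_exp_neg_div (x : ℝ) :
    Tendsto (fun y : ℝ => y * (1 - Real.exp (-(x / y)))) atTop (nhds x) := by
  have hd : HasDerivAt (fun z : ℝ => 1 - Real.exp (-(x * z))) x 0 := by
    simpa using (((hasDerivAt_id (0 : ℝ)).const_mul x).neg.exp).const_sub 1
  have ht := (hasDerivAt_iff_tendsto_slope_zero.1 hd).comp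
    (tendsto_inv_atTop_nhdsGT_zero.mono_right (nhdsWithin_mono (0 : ℝ) fun z hz => ne_of_gt hz))
  refine ht.congr fun y => ?_
  simp [div_eq_mul_inv]

theorem tendsto_fVar_div_rpow {α c a : ℝ} (hα : α ∈ Ioo (0 : ℝ) 1) (hc : 0 < c) :
    Tendsto (fun T : ℝ => fVar α c a T / T ^ (1 - α)) atTop
      (nhds ((4 * c / (a * Real.pi)) * Real.Gamma (α - 1) * Real.sin (-α * Real.pi / 2))) := by
  obtain ⟨hi, hv⟩ := integral_one_sub_cos_mul_rpow_s15 hα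
  have hsin : ∀ u : ℝ, Real.sin (u / 2) ^ 2 = (1 - Real.cos u) / 2 := fun u => by
    rw [Real.sin_sq_eq_half_sub, show 2 * (u / 2) = u by ring]; ring
  have hlim : Tendsto (fun T : ℝ => ∫ u in Ioi (0 : ℝ),
      Real.sin (u / 2) ^ 2 * (T ^ α * (1 - Real.exp (-(2 * c * u ^ α / T ^ α)))) / u ^ 2) atTop
      (nhds (∫ u in Ioi (0 : ℝ), c * ((1 - Real.cos u) * u ^ (α - 2)))) := by
    have hlimit : ∀ u ∈ Ioi (0 : ℝ), Real.sin (u / 2) ^ 2 * (2 * c * u ^ α) / u ^ 2 =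
        c * ((1 - Real.cos u) * u ^ (α - 2)) := fun u hu => by
      rw [hsin, Real.rpow_sub hu, Real.rpow_two]; ring
    refine tendsto_integral_filter_of_dominated_convergence
      (fun u => c * ((1 - Real.cos u) * u ^ (α - 2))) ?_ ?_ (hi.const_mul c) ?_
    · exact Eventually.of_forall fun T => Measurable.aestronglyMeasurable (by fun_prop)
    · filter_upwards [eventually_gt_atTop 0] with T hT
      filter_upwards [ae_restrict_mem measurableSet_Ioi] with u hu
      have hu' : (0 : ℝ) < u := hu
      have hTα : 0 < T ^ α := Real.rpow_pos_of_pos hT _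
      have hq : 0 ≤ 2 * c * u ^ α / T ^ α := by positivity
      have hnn : 0 ≤ 1 - Real.exp (-(2 * c * u ^ α / T ^ α)) :=
        sub_nonneg.2 (Real.exp_le_one_iff.2 (neg_nonpos.2 hq))
      have hle : T ^ α * (1 - Real.exp (-(2 * c * u ^ α / T ^ α))) ≤ 2 * c * u ^ α := by
        have := Real.add_one_le_exp (-(2 * c * u ^ α / T ^ α))
        calc _ ≤ T ^ α * (2 * c * u ^ α / T ^ α) := by gcongr; linarith
          _ = _ := by field_simp
      rw [Real.norm_of_nonneg (by positivity), ← hlimit u hu]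
      gcongr
    · filter_upwards [ae_restrict_mem measurableSet_Ioi] with u hu
      rw [← hlimit u hu]
      exact (((tendsto_mul_one_sub_exp_neg_div _).comp (tendsto_rpow_atTop hα.1)).const_mul
        _).div_const _
  rw [integral_const_mul, hv] at hlim
  have hlim' := hlim.const_mul (4 / (a * Real.pi))
  rw [show 4 / (a * Real.pi) * (c * (Real.Gamma (α - 1) * Real.sin (-α * Real.pi / 2))) =
    4 * c / (a * Real.pi) * Real.Gamma (α - 1) * Real.sin (-α * Real.pi / 2) by ring] at hlim'
  refine hlim'.congr' ?_
  filter_upwards [eventually_gt_atTop 0] with T hT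
  have hint : ∫ u in Ioi (0 : ℝ),
      Real.sin (u / 2) ^ 2 * (T ^ α * (1 - Real.exp (-(2 * c * u ^ α / T ^ α)))) / u ^ 2 =
      T ^ α * ∫ u in Ioi (0 : ℝ),
        Real.sin (u / 2) ^ 2 * (1 - Real.exp (-(2 * c * (u / T) ^ α))) / u ^ 2 := by
    rw [← integral_const_mul]
    refine setIntegral_congr_fun measurableSet_Ioi fun u hu => ?_
    simp only [Real.div_rpow (le_of_lt hu) hT.le, mul_div_assoc]
    ring
  have hTα : 0 < T ^ α := Real.rpow_pos_of_pos hT _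
  rw [hint, fVar, Real.rpow_sub hT, Real.rpow_one]
  field_simp

theorem tendsto_fVar_mul_div_rpow {α c a s : ℝ} (hα : α ∈ Ioo (0 : ℝ) 1) (hc : 0 < c)
    (hs : 0 ≤ s) :
    Tendsto (fun b : ℝ => fVar α c a (b * s) / b ^ (1 - α)) atTop
      (nhds ((4 * c / (a * Real.pi)) * Real.Gamma (α - 1) *
        Real.sin (-α * Real.pi / 2) * s ^ (1 - α))) := by
  rcases hs.eq_or_lt with rfl | hs
  · simp [fVar, Real.zero_rpow (sub_pos.2 hα.2).ne']
  · refine (((tendsto_fVar_div_rpow hα hc).comp (tendsto_id.atTop_mul_const hs)).mul_const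
      (s ^ (1 - α))).congr' ?_
    filter_upwards [eventually_gt_atTop 0] with b hb
    have hsα : 0 < s ^ (1 - α) := Real.rpow_pos_of_pos hs _
    simp only [Function.comp_apply, id_eq, Real.mul_rpow hb.le hs.le]
    field_simp

theorem fBM_scaling_limit (α c a : ℝ) (hα : α ∈ Set.Ioo (0:ℝ) 1)
    (hc : 0 < c) (ha : 0 < a) :
    (∀ s : ℝ, 0 < s →
      Tendsto (fun b : ℝ => fVar α c a (b * s) / b ^ (1 - α)) atTop
        (nhds ((4 * c / (a * Real.pi)) * Real.Gamma (α - 1) *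
          Real.sin (-α * Real.pi / 2) * s ^ (1 - α)))) ∧
    ∀ s r : ℝ, 0 < s → 0 < r →
      Tendsto (fun b : ℝ => b ^ (α - 1) *
          ((1 / 2) * (fVar α c a (b * r) + fVar α c a (b * s) -
            fVar α c a (b * |s - r|)))) atTop
        (nhds (((4 * c / (a * Real.pi)) * Real.Gamma (α - 1) *
            Real.sin (-α * Real.pi / 2) / 2) *
          (s ^ (1 - α) + r ^ (1 - α) - |s - r| ^ (1 - α)))) := by
  refine ⟨fun s hs => tendsto_fVar_mul_div_rpow hα hc hs.le, fun s r hs hr => ?_⟩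
  have h := (((tendsto_fVar_mul_div_rpow (a := a) hα hc hr.le).add
    (tendsto_fVar_mul_div_rpow (a := a) hα hc hs.le)).sub
    (tendsto_fVar_mul_div_rpow (a := a) hα hc (abs_nonneg (s - r)))).const_mul (1 / 2)
  refine (h.congr' ?_).trans_eq (congrArg nhds (by ring))
  filter_upwards [eventually_gt_atTop 0] with b hb
  rw [← neg_sub 1 α, Real.rpow_neg hb.le]
  ring
end
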